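/- arXiv:1403.5975 — 2 statements merged into one kernel-verified Lean document; each statement's English description precedes it below -/
import Mathlib

section
/- For every natural number n, if the edges of the complete graph K_n are coloured so that the colouring is 2-local (every vertex is incident to edges of at most 2 distinct colours), then the vertex set of K_n can be partitioned into two disjoint monochromatic cycles whose colours are different. -/
/-- `S` is the vertex set of a monochromatic cycle of colour `col` in the complete graph `K_n`
whose edges are coloured by `χ`; the empty set, single vertices and single edges count as
degenerate cycles (the empty set being a cycle of any colour). -/
def IsMonoCycle {n : ℕ} (χ : Fin n → Fin n → ℕ) (col : ℕ) (S : Finset (Fin n)) : Prop :=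
  S = ∅ ∨
  (∃ v, S = {v}) ∨
  (∃ v w : Fin n, v ≠ w ∧ S = {v, w} ∧ χ v w = col) ∨
  (∃ (v : Fin n) (p : (⊤ : SimpleGraph (Fin n)).Walk v v),
    p.IsCycle ∧ p.support.toFinset = S ∧ ∀ x y : Fin n, s(x, y) ∈ p.edges → χ x y = col)

set_option linter.unusedSimpArgs false
set_option linter.unusedSectionVars false
namespace Lehel

variable {V : Type*}

inductive Seg (R : V → V → Prop) : V → V → List V → Prop
  | one (u : V) : Seg R u u [u]
  | cons {u w v : V} {l : List V} : R u w → Seg R w v l → Seg R u v (u :: l)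

theorem Seg.app {R : V → V → Prop} {u v w z : V} {l m : List V} (h : Seg R u v l) (hr : R v w)
    (h' : Seg R w z m) : Seg R u z (l ++ m) := by
  induction h with
  | one u => exact Seg.cons hr h'
  | cons h1 _ ih => exact Seg.cons h1 (ih hr)

theorem Seg.snoc {R : V → V → Prop} {u v w : V} {l : List V} (h : Seg R u v l) (hr : R v w) :
    Seg R u w (l ++ [w]) := h.app hr (Seg.one w)

theorem Seg.rev {R : V → V → Prop} (hs : ∀ u v, R u v → R v u) {u v : V} {l : List V}
    (h : Seg R u v l) : Seg R v u l.reverse := by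
  induction h with
  | one u => exact Seg.one u
  | cons h1 _ ih => rw [List.reverse_cons]; exact ih.snoc (hs _ _ h1)

theorem Seg.mono {R S : V → V → Prop} (hs : ∀ u v, R u v → S u v) {u v : V} {l : List V}
    (h : Seg R u v l) : Seg S u v l := by
  induction h with
  | one u => exact Seg.one u
  | cons h1 _ ih => exact Seg.cons (hs _ _ h1) ih

def Cyc (R : V → V → Prop) (l : List V) : Prop := l = [] ∨ ∃ u v, Seg R u v l ∧ R v u
def Pth (R : V → V → Prop) (l : List V) : Prop := l = [] ∨ ∃ u v, Seg R u v l

theorem Seg.cyc {R : V → V → Prop} {u v : V} {l : List V} (h : Seg R u v l) (h2 : R v u) :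
    Cyc R l := Or.inr ⟨u, v, h, h2⟩
theorem Seg.pth {R : V → V → Prop} {u v : V} {l : List V} (h : Seg R u v l) :
    Pth R l := Or.inr ⟨u, v, h⟩

variable [DecidableEq V]

structure Ctx (b r : V → V → Prop) (U : V → ℕ) (k : ℕ) : Prop where
  bs : ∀ u v, b u v → b v u
  rs : ∀ u v, r u v → r v u
  br : ∀ u, b u u
  rr : ∀ u, r u u
  tot : ∀ u v, b u v ∨ r u v
  hb : ∀ C P, Cyc b C → Pth r P → (∀ a, (C ++ P).count a = U a) → C.length ≤ k
  hr : ∀ C P, Cyc r C → Pth b P → (∀ a, (C ++ P).count a = U a) → C.length ≤ k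
  hno : ∀ C P, Cyc b C → Cyc r P → (∀ a, (C ++ P).count a = U a) → False

/-- an optimal pair: blue cycle `C`, red path `x M y` -/
structure Opt (b r : V → V → Prop) (U : V → ℕ) (k : ℕ) (C : List V) (x x' : V) (M : List V)
    (y' y : V) : Prop where
  ctx : Ctx b r U k
  cyc : Cyc b C
  len : C.length = k
  sM : Seg r x' y' M
  hx : r x x'
  hy : r y' y
  cov : ∀ a, (C ++ (x :: y :: M)).count a = U a

variable {b r : V → V → Prop} {U : V → ℕ} {k : ℕ} {C M : List V} {x x' y' y : V}

theorem Opt.swap (h : Opt b r U k C x x' M y' y) : Opt b r U k C y y' M.reverse x' x where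
  ctx := h.ctx
  cyc := h.cyc
  len := h.len
  sM := h.sM.rev h.ctx.rs
  hx := h.ctx.rs _ _ h.hy
  hy := h.ctx.rs _ _ h.hx
  cov := by
    intro a
    have := h.cov a
    simp only [List.count_append, List.count_cons, List.count_reverse, List.count_nil] at this ⊢
    omega

theorem Opt.change (h : Opt b r U k C x x' M y' y) {D : List V} (hD : D.Perm C)
    (hc : Cyc b D) : Opt b r U k D x x' M y' y where
  ctx := h.ctx
  cyc := hc
  len := by rw [hD.length_eq, h.len]
  sM := h.sM
  hx := h.hx
  hy := h.hy
  cov := by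
    intro a
    rw [← h.cov a, List.count_append, List.count_append, hD.count_eq]

theorem Opt.bxy (h : Opt b r U k C x x' M y' y) : b x y := by
  rcases h.ctx.tot x y with h1 | h1
  · exact h1
  · exfalso
    refine h.ctx.hno C ((x :: M) ++ [y]) h.cyc
      (((Seg.cons h.hx h.sM).snoc h.hy).cyc (h.ctx.rs _ _ h1)) ?_
    intro a
    have := h.cov a
    simp only [List.count_append, List.count_cons, List.count_reverse, List.count_nil] at this ⊢
    omega

def NN (b : V → V → Prop) (x y c : V) : Prop := b c x ∨ b c y

theorem Opt.red (h : Opt b r U k C x x' M y' y) {c : V} (hc : ¬ NN b x y c) : r c x ∧ r c y :=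
  ⟨(h.ctx.tot c x).resolve_left fun h => hc (Or.inl h),
    (h.ctx.tot c y).resolve_left fun h => hc (Or.inr h)⟩

/-- two vertices joined by a blue Hamiltonian path of the cycle set are not both `NN` -/
theorem Opt.F1 (h : Opt b r U k C x x' M y' y) {a z : V} {D : List V} (hD : Seg b a z D)
    (hp : D.Perm C) (ha : NN b x y a) (hz : NN b x y z) : False := by
  have hl := hp.length_eq
  have hk := h.len
  have bs := h.ctx.bs
  have hxy := h.bxy
  have key1 : ∀ {u}, b z x → b x u → u = a → False := by
    rintro u h1 h2 rfl
    have := h.ctx.hb (D ++ [x]) (M ++ [y]) ((hD.snoc h1).cyc h2) (h.sM.snoc h.hy).pth (by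
      intro a
      have := h.cov a
      have := hp.count_eq a
      simp only [List.count_append, List.count_cons, List.count_reverse, List.count_nil] at *
      omega)
    simp at this; omega
  have key2 : b z y → b y a → False := by
    intro h1 h2
    have := h.ctx.hb (D ++ [y]) (x :: M) ((hD.snoc h1).cyc h2) (Seg.cons h.hx h.sM).pth (by
      intro a
      have := h.cov a
      have := hp.count_eq a
      simp only [List.count_append, List.count_cons, List.count_reverse, List.count_nil] at *
      omega)
    simp at this; omega
  have key3 : b z x → b y a → False := by
    intro h1 h2
    have := h.ctx.hb (D ++ [x] ++ [y]) M (((hD.snoc h1).snoc hxy).cyc h2) h.sM.pth (by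
      intro a
      have := h.cov a
      have := hp.count_eq a
      simp only [List.count_append, List.count_cons, List.count_reverse, List.count_nil] at *
      omega)
    simp at this; omega
  have key4 : b z y → b x a → False := by
    intro h1 h2
    have := h.ctx.hb (D ++ [y] ++ [x]) M (((hD.snoc h1).snoc (bs _ _ hxy)).cyc h2) h.sM.pth (by
      intro a
      have := h.cov a
      have := hp.count_eq a
      simp only [List.count_append, List.count_cons, List.count_reverse, List.count_nil] at *
      omega)
    simp at this; omega
  rcases ha with ha | ha <;> rcases hz with hz | hz
  · exact key1 hz (bs _ _ ha) rfl
  · exact key4 hz (bs _ _ ha)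
  · exact key3 hz (bs _ _ ha)
  · exact key2 hz (bs _ _ ha)

theorem Opt.big (h : Opt b r U k C x x' M y' y) {D Q : List V} (hD : Cyc b D) (hQ : Pth r Q)
    (hc : ∀ a, (D ++ Q).count a = (C ++ (x :: y :: M)).count a) (hl : C.length < D.length) :
    False := by
  have := h.ctx.hb D Q hD hQ (fun a => (hc a).trans (h.cov a))
  have := h.len
  omega

theorem Opt.fin (h : Opt b r U k C x x' M y' y) {D Q : List V} (hD : Cyc b D) (hQ : Cyc r Q)
    (hc : ∀ a, (D ++ Q).count a = (C ++ (x :: y :: M)).count a) : False :=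
  h.ctx.hno D Q hD hQ (fun a => (hc a).trans (h.cov a))

theorem Opt.F2 (h : Opt b r U k C x x' M y' y) {a c z : V} {T : List V} (hT : Seg b c z T)
    (hp : (a :: T).Perm C) (ha : ¬ NN b x y a) : r c z := by
  obtain ⟨hax, hay⟩ := h.red ha
  rcases h.ctx.tot z c with h1 | h1
  · exfalso
    refine h.fin (D := T) (Q := ((x :: M) ++ [y]) ++ [a]) (hT.cyc h1)
      ((((Seg.cons h.hx h.sM).snoc h.hy).snoc (h.ctx.rs _ _ hay)).cyc hax) ?_
    intro a
    have := hp.count_eq a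
    simp only [List.count_append, List.count_cons, List.count_reverse, List.count_nil] at *
    omega
  · exact h.ctx.rs _ _ h1

theorem Opt.kge (h : Opt b r U k C x x' M y' y) {a c z : V} {T : List V} (hT : Seg b c z T)
    (hp : (a :: T).Perm C) (ha : ¬ NN b x y a) : M.length + 3 ≤ k := by
  obtain ⟨hax, hay⟩ := h.red ha
  have := h.ctx.hr (((x :: M) ++ [y]) ++ [a]) T
      ((((Seg.cons h.hx h.sM).snoc h.hy).snoc (h.ctx.rs _ _ hay)).cyc hax) hT.pth (by
    intro a
    have := hp.count_eq a
    have := h.cov a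
    simp only [List.count_append, List.count_cons, List.count_reverse, List.count_nil] at *
    omega)
  simp at this
  omega

theorem Opt.F4 (h : Opt b r U k C x x' M y' y) {a u v : V} {S : List V} (hS : Seg b u v S)
    (hp : (a :: S).Perm C) (ha : ¬ NN b x y a) (hu : b u x) (hv : NN b x y v) : b a x' := by
  rcases h.ctx.tot a x' with h1 | h1
  · exact h1
  exfalso
  have hl := hp.length_eq
  have bs := h.ctx.bs
  rcases hv with hv | hv
  · refine h.fin (D := S ++ [x]) (Q := M ++ [y] ++ [a]) ((hS.snoc hv).cyc (bs _ _ hu))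
        (((h.sM.snoc h.hy).snoc (h.ctx.rs _ _ (h.red ha).2)).cyc h1) ?_
    intro a
    have := hp.count_eq a
    simp only [List.count_append, List.count_cons, List.count_reverse, List.count_nil] at *
    omega
  · refine h.big (D := S ++ [y] ++ [x]) (Q := a :: M)
      (((hS.snoc hv).snoc (bs _ _ h.bxy)).cyc (bs _ _ hu)) (Seg.cons h1 h.sM).pth ?_ ?_
    · intro a
      have := hp.count_eq a
      simp only [List.count_append, List.count_cons, List.count_reverse, List.count_nil] at *
      omega
    · simp at *; omega

/-- five consecutive vertices of the cycle (the first and last may agree) -/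
structure Five (b : V → V → Prop) (C : List V) (c0 c1 c2 c3 c4 : V) (T : List V) : Prop where
  e01 : b c0 c1
  e12 : b c1 c2
  e23 : b c2 c3
  e34 : b c3 c4
  sT : Seg b c4 c0 T
  perm : (c1 :: c2 :: c3 :: T).Perm C

theorem Five.symm {c0 c1 c2 c3 c4 : V} {T : List V} (f : Five b C c0 c1 c2 c3 c4 T)
    (bs : ∀ u v, b u v → b v u) : Five b C c4 c3 c2 c1 c0 T.reverse where
  e01 := bs _ _ f.e34
  e12 := bs _ _ f.e23
  e23 := bs _ _ f.e12
  e34 := bs _ _ f.e01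
  sT := f.sT.rev bs
  perm := by
    rw [List.perm_iff_count]
    intro a
    have := f.perm.count_eq a
    simp only [List.count_append, List.count_cons, List.count_reverse, List.count_nil] at *
    omega

theorem Five.perm1 {c0 c1 c2 c3 c4 : V} {T : List V} (f : Five b C c0 c1 c2 c3 c4 T) :
    Seg b c2 c0 (c2 :: c3 :: T) ∧ (c1 :: (c2 :: c3 :: T)).Perm C :=
  ⟨Seg.cons f.e23 (Seg.cons f.e34 f.sT), f.perm⟩

theorem Opt.notN1 (h : Opt b r U k C x x' M y' y) {c0 c1 c2 c3 c4 : V} {T : List V}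
    (f : Five b C c0 c1 c2 c3 c4 T) (h0 : NN b x y c0) : ¬ NN b x y c1 := fun h1 =>
  h.F1 (Seg.cons f.e12 f.perm1.1) f.perm1.2 h1 h0

theorem Opt.F5a (h : Opt b r U k C x x' M y' y) {c0 c1 c2 c3 c4 : V} {T : List V}
    (f : Five b C c0 c1 c2 c3 c4 T) (h0 : b c0 x) (h2 : b c2 x) (h4 : NN b x y c4) : False := by
  have bs := h.ctx.bs
  have f' := f.symm bs
  have n1 := h.notN1 f (Or.inl h0)
  have n3 := h.notN1 f' h4
  have b1 : b c1 x' := h.F4 f.perm1.1 f.perm1.2 n1 h2 (Or.inl h0)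
  have b3 : b c3 x' := h.F4 f'.perm1.1 f'.perm1.2 n3 h2 h4
  have hl := f.perm.length_eq
  have hD : Seg b c4 c3 (T ++ [x] ++ [c2] ++ [c1] ++ [x'] ++ [c3]) :=
    ((((f.sT.snoc h0).snoc (bs _ _ h2)).snoc (bs _ _ f.e12)).snoc b1).snoc (bs _ _ b3)
  obtain ⟨M', hM', hP⟩ : ∃ M', M = x' :: M' ∧ Pth r (M' ++ [y]) := by
    rcases h.sM with _ | ⟨h1, h2⟩
    · exact ⟨[], rfl, (Seg.one _).pth⟩
    · exact ⟨_, rfl, (h2.snoc h.hy).pth⟩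
  refine h.big (hD.cyc f.e34) hP ?_ ?_
  · intro a
    have := f.perm.count_eq a
    subst hM'
    simp only [List.count_append, List.count_cons, List.count_reverse, List.count_nil] at *
    omega
  · simp at *; omega

theorem Opt.F5c (h : Opt b r U k C x x' M y' y) {c0 c1 c2 c3 c4 : V} {T : List V}
    (f : Five b C c0 c1 c2 c3 c4 T) (h0 : b c0 x) (h2 : b c2 y) (h4 : b c4 x) : False := by
  have bs := h.ctx.bs
  have f' := f.symm bs
  have n1 := h.notN1 f (Or.inl h0)
  have n3 := h.notN1 f' (Or.inl h4)
  have b1 : b c1 x' := h.F4 (f.perm1.1.rev bs) (((List.reverse_perm _).cons _).trans f.perm1.2)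
    n1 h0 (Or.inr h2)
  have b3 : b c3 x' := h.F4 (f'.perm1.1.rev bs) (((List.reverse_perm _).cons _).trans f'.perm1.2)
    n3 h4 (Or.inr h2)
  have hl := f.perm.length_eq
  have hD : Seg b c4 c3 (T ++ [x] ++ [y] ++ [c2] ++ [c1] ++ [x'] ++ [c3]) :=
    (((((f.sT.snoc h0).snoc h.bxy).snoc (bs _ _ h2)).snoc (bs _ _ f.e12)).snoc b1).snoc (bs _ _ b3)
  obtain ⟨M', hM', hP⟩ : ∃ M', M = x' :: M' ∧ Pth r M' := by
    rcases h.sM with _ | ⟨h1, h2⟩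
    · exact ⟨[], rfl, Or.inl rfl⟩
    · exact ⟨_, rfl, h2.pth⟩
  refine h.big (hD.cyc f.e34) hP ?_ ?_
  · intro a
    have := f.perm.count_eq a
    subst hM'
    simp only [List.count_append, List.count_cons, List.count_reverse, List.count_nil] at *
    omega
  · simp at *; omega

theorem Opt.F5 (h : Opt b r U k C x x' M y' y) {c0 c1 c2 c3 c4 : V} {T : List V}
    (f : Five b C c0 c1 c2 c3 c4 T) (h0 : NN b x y c0) (h2 : NN b x y c2) (h4 : NN b x y c4) :
    False := by
  have f' := f.symm h.ctx.bs
  have sw : ∀ {c}, NN b x y c → NN b y x c := fun h => h.symm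
  rcases h0 with a0 | a0 <;> rcases h2 with a2 | a2 <;> rcases h4 with a4 | a4
  · exact h.F5a f a0 a2 (Or.inl a4)
  · exact h.F5a f a0 a2 (Or.inr a4)
  · exact h.F5c f a0 a2 a4
  · exact h.swap.F5a f' a4 a2 (Or.inr a0)
  · exact h.F5a f' a4 a2 (Or.inr a0)
  · exact h.swap.F5c f a0 a2 a4
  · exact h.swap.F5a f a0 a2 (Or.inr a4)
  · exact h.swap.F5a f a0 a2 (Or.inl a4)

theorem Opt.F6 (h : Opt b r U k C x x' M y' y) {c0 c1 c2 c3 c4 e : V} {T E O1 O2 : List V}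
    (f : Five b C c0 c1 c2 c3 c4 T) (n1 : ¬ NN b x y c1) (n2 : ¬ NN b x y c2)
    (n3 : ¬ NN b x y c3) (ne : ¬ NN b x y e) (hE : Seg r c1 e E) (hO1 : Seg r c2 c4 O1)
    (hO2 : Seg r c2 c0 O2) (p1 : (E ++ O1).Perm C) (p2 : (E ++ O2).Perm C) : False := by
  have bs := h.ctx.bs
  have rs := h.ctx.rs
  have f' := f.symm bs
  have hl := f.perm.length_eq
  have r13 : r c1 c3 := by
    refine rs _ _ (h.F2 (a := c2) (T := [c3] ++ T ++ [c1])
      (((Seg.one c3).app f.e34 f.sT).snoc f.e01) ?_ n2)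
    rw [List.perm_iff_count]
    intro a
    have := f.perm.count_eq a
    simp only [List.count_append, List.count_cons, List.count_reverse, List.count_nil] at *
    omega
  obtain ⟨r1x, r1y⟩ := h.red n1
  obtain ⟨r2x, r2y⟩ := h.red n2
  obtain ⟨r3x, r3y⟩ := h.red n3
  obtain ⟨rex, rey⟩ := h.red ne
  have hP : Seg r x y ((x :: M) ++ [y]) := (Seg.cons h.hx h.sM).snoc h.hy
  have b14 : b c4 c1 := by
    refine (h.ctx.tot c4 c1).resolve_right fun h1 => ?_
    refine h.fin (D := []) (Or.inl rfl) (((hP.app (rs _ _ r2y) hO1).app h1 hE).cyc rex) ?_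
    intro a
    have := p1.count_eq a
    simp only [List.count_append, List.count_cons, List.count_reverse, List.count_nil] at *
    omega
  have bx' : ∀ {o O}, Seg r c2 o O → (E ++ O).Perm C → b o x' := by
    intro o O hO p
    refine (h.ctx.tot o x').resolve_right fun h1 => ?_
    refine h.fin (D := []) (Or.inl rfl)
      (((((h.sM.snoc h.hy).app (rs _ _ r1y) hE).snoc rex).app (rs _ _ r2x) hO).cyc h1) ?_
    intro a
    have := p.count_eq a
    simp only [List.count_append, List.count_cons, List.count_reverse, List.count_nil] at *
    omega
  have b4x' := bx' hO1 p1
  have b0x' := bx' hO2 p2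
  have b3x' : b c3 x' := by
    refine (h.ctx.tot c3 x').resolve_right fun h1 => ?_
    refine h.fin ((Seg.cons (bs _ _ b14) f.sT).cyc f.e01)
      ((((((Seg.one x).snoc (rs _ _ r3x)).app h1 h.sM).snoc h.hy).snoc (rs _ _ r2y)).cyc r2x) ?_
    intro a
    have := f.perm.count_eq a
    simp only [List.count_append, List.count_cons, List.count_reverse, List.count_nil] at *
    omega
  -- the path from x'' to y
  have key : ∀ {x'' Y}, Seg r x'' y Y → (∀ a, (x' :: Y).count a = (M ++ [y]).count a) →
      b c3 x'' ∧ b c1 x'' := by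
    intro x'' Y hY hc
    constructor
    · refine (h.ctx.tot c3 x'').resolve_right fun h1 => ?_
      refine h.fin ((f.sT.snoc b0x').cyc (bs _ _ b4x'))
        (((((hY.snoc (rs _ _ r2y)).snoc r2x).snoc (rs _ _ r1x)).snoc r13).cyc h1) ?_
      intro a
      have := f.perm.count_eq a
      have := hc a
      simp only [List.count_append, List.count_cons, List.count_reverse, List.count_nil] at *
      omega
    · refine (h.ctx.tot c1 x'').resolve_right fun h1 => ?_
      refine h.fin ((f.sT.snoc b0x').cyc (bs _ _ b4x'))
        (((((hY.snoc (rs _ _ r2y)).snoc r2x).snoc (rs _ _ r3x)).snoc (rs _ _ r13)).cyc h1) ?_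
      intro a
      have := f.perm.count_eq a
      have := hc a
      simp only [List.count_append, List.count_cons, List.count_reverse, List.count_nil] at *
      omega
  have big : ∀ {x'' Q}, b c3 x'' → b c1 x'' → Pth r (Q ++ [c2] ++ [x]) →
      (∀ a, (x' :: x'' :: Q).count a = (M ++ [y]).count a) → False := by
    intro x'' Q h3 h1 hQ hc
    refine h.big
      (((((f.sT.snoc f.e01).snoc h1).snoc (bs _ _ h3)).snoc b3x').cyc (bs _ _ b4x')) hQ ?_ ?_
    · intro a
      have := f.perm.count_eq a
      have := hc a
      simp only [List.count_append, List.count_cons, List.count_reverse, List.count_nil] at *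
      omega
    · simp at *; omega
  have hsM := h.sM
  have hhy := h.hy
  rcases hsM with _ | ⟨h1, h2⟩
  · obtain ⟨k3, k1⟩ := key (Seg.one y) (by intro a; simp)
    exact n3 (Or.inr k3)
  · obtain ⟨k3, k1⟩ := key (h2.snoc hhy) (by intro a; simp)
    rcases h2 with _ | ⟨h3, h4⟩
    · exact big (Q := [y]) k3 k1 ((((Seg.one y).snoc (rs _ _ r2y)).snoc r2x).pth) (by intro a; simp)
    · exact big k3 k1 ((((h4.snoc hhy).snoc (rs _ _ r2y)).snoc r2x).pth) (by intro a; simp)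
theorem Seg.rev' {R S : V → V → Prop} (hs : ∀ u v, R u v → S v u) {u v : V} {l : List V}
    (h : Seg R u v l) : Seg S v u l.reverse := by
  induction h with
  | one u => exact Seg.one u
  | cons h1 _ ih => rw [List.reverse_cons]; exact ih.snoc (hs _ _ h1)

def TT (r : V → V → Prop) (A B : V → Prop) (u v : V) : Prop := r u v ∨ (B u ∧ A v)

theorem joinLem (rs : ∀ u v, r u v → r v u) : ∀ (n : ℕ) (A B : V → Prop)
    (_ : ∀ u v, A u → A v → r u v) (_ : ∀ u v, B u → B v → r u v) (l : List V) (u z : V)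
    (_ : Seg (TT r A B) u z l) (_ : l.length = n) (_ : B z),
    ∃ l' e, Seg r u e l' ∧ l'.Perm l ∧ (A e ∨ B e) := by
  intro n
  induction n with
  | zero =>
    intro A B hA hB l u z hl hn hz
    cases hl <;> simp at hn
  | succ n ih =>
    intro A B hA hB l u z hl hn hz
    cases hl with
    | one => exact ⟨[u], u, Seg.one u, List.Perm.refl _, Or.inr hz⟩
    | @cons _ w _ l h1 h2 =>
      rcases h1 with h1 | ⟨h1, h3⟩
      · obtain ⟨l', e, k1, k2, k3⟩ := ih A B hA hB l w z h2 (by simpa using hn) hz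
        exact ⟨u :: l', e, Seg.cons h1 k1, k2.cons _, k3⟩
      · have h4 : Seg (TT r B A) z w l.reverse := h2.rev' (fun u v huv => by
          rcases huv with h | ⟨h, h'⟩
          · exact Or.inl (rs _ _ h)
          · exact Or.inr ⟨h', h⟩)
        obtain ⟨l', e, k1, k2, k3⟩ := ih B A hB hA _ z w h4 (by simpa using hn) h3
        exact ⟨u :: l', e, Seg.cons (hB _ _ h1 hz) k1, (k2.trans (List.reverse_perm _)).cons _,
          k3.symm⟩

def II (c : ℕ → V) (i n s : ℕ) : List V := (List.range' i n s).map c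

theorem II_succ (c : ℕ → V) (i n s : ℕ) : II c i (n + 1) s = c i :: II c (i + s) n s := rfl

theorem II_add (c : ℕ → V) (i m n s : ℕ) :
    II c i (m + n) s = II c i m s ++ II c (i + s * m) n s := by
  unfold II
  rw [← List.map_append, List.range'_append]

theorem II_seg {R : V → V → Prop} (c : ℕ → V) (s : ℕ) :
    ∀ (n i : ℕ), (∀ j, R (c (i + s * j)) (c (i + s * j + s))) →
      Seg R (c i) (c (i + s * n)) (II c i (n + 1) s) := by
  intro n
  induction n with
  | zero => intro i _; exact Seg.one _
  | succ n ih =>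
    intro i h
    rw [II_succ]
    refine Seg.cons (by simpa using h 0) ?_
    have := ih (i + s) (fun j => by
      have := h (j + 1)
      convert this using 2 <;> ring)
    convert this using 2
    ring

theorem II_per (c : ℕ → V) (k : ℕ) (hper : ∀ i, c (i + k) = c i) (i n s : ℕ) :
    II c (i + k) n s = II c i n s := by
  induction n generalizing i with
  | zero => rfl
  | succ n ih =>
    rw [II_succ, II_succ, hper, show i + k + s = i + s + k by ring, ih]

theorem II_split (c : ℕ → V) (i m : ℕ) :
    (II c i (2 * m) 1).Perm (II c i m 2 ++ II c (i + 1) m 2) := by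
  induction m generalizing i with
  | zero => exact List.Perm.refl _
  | succ m ih =>
    rw [show 2 * (m + 1) = 2 * m + 1 + 1 by ring, II_succ, II_succ, II_succ, II_succ]
    rw [List.perm_iff_count]
    intro a
    have := (ih (i + 2)).count_eq a
    rw [show i + 1 + 2 = i + 2 + 1 by ring, show i + 1 + 1 = i + 2 by ring]
    simp only [List.count_append, List.count_cons, List.count_reverse, List.count_nil] at *
    omega

theorem Seg.fst {R : V → V → Prop} {u v : V} {l : List V} (h : Seg R u v l) :
    ∃ h0 : 0 < l.length, l[0] = u := by
  cases h <;> simp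

theorem Seg.lst {R : V → V → Prop} {u v : V} {l : List V} (h : Seg R u v l) :
    ∃ h0 : l.length - 1 < l.length, l[l.length - 1] = v := by
  induction h with
  | one => simp
  | cons h1 h2 ih =>
    obtain ⟨h0, h3⟩ := ih
    refine ⟨by simp, ?_⟩
    rw [List.getElem_cons]
    simp only [List.length_cons, Nat.add_sub_cancel]
    rw [dif_neg (by omega)]
    exact h3

theorem Seg.nxt {R : V → V → Prop} {u v : V} {l : List V} (h : Seg R u v l) :
    ∀ (i : ℕ) (hi : i + 1 < l.length), R (l[i]) (l[i + 1]) := by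
  induction h with
  | one => intro i hi; simp at hi
  | cons h1 h2 ih =>
    intro i hi
    cases i with
    | zero =>
      obtain ⟨h0, h3⟩ := h2.fst
      simpa [h3] using h1
    | succ i => simpa using ih i (by simpa using hi)

theorem cyc_fun {C : List V} (hC : Cyc b C) (hk : C.length = k) (hpos : 0 < k) :
    ∃ c : ℕ → V, (∀ i, c (i + k) = c i) ∧ (∀ i, b (c i) (c (i + 1))) ∧ II c 0 k 1 = C := by
  rcases hC with rfl | ⟨u, v, hs, hvu⟩
  · simp at hk; omega
  refine ⟨fun i => C[i % k]'(by rw [hk]; exact Nat.mod_lt _ hpos), ?_, ?_, ?_⟩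
  · intro i
    simp
  · intro i
    have h1 := Nat.mod_lt i hpos
    by_cases h2 : i % k + 1 < k
    · have h3 : (i + 1) % k = i % k + 1 := by
        rw [Nat.add_mod, Nat.mod_eq_of_lt (a := 1) (by omega), Nat.mod_eq_of_lt h2]
      have := hs.nxt (i % k) (by omega)
      simpa [h3] using this
    · have h4 : i % k = C.length - 1 := by omega
      have h3 : (i + 1) % k = 0 := by
        rw [← Nat.mod_add_mod, show i % k + 1 = k by omega, Nat.mod_self]
      obtain ⟨_, e1⟩ := hs.lst
      obtain ⟨_, e2⟩ := hs.fst
      simp only [h3, h4, e1, e2]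
      exact hvu
  · apply List.ext_getElem
    · simp [II, hk]
    · intro i h1 h2
      have : i % k = i := Nat.mod_eq_of_lt (by omega)
      simp [II, this]

theorem II_rot (c : ℕ → V) (hper : ∀ i, c (i + k) = c i) (i : ℕ) (hpos : 0 < k) :
    (II c i k 1).Perm (II c 0 k 1) := by
  induction i with
  | zero => exact List.Perm.refl _
  | succ i ih =>
    refine List.Perm.trans ?_ ih
    obtain ⟨k', rfl⟩ : ∃ k', k = k' + 1 := ⟨k - 1, by omega⟩
    rw [II_add c (i + 1) k' 1 1, II_succ c i k' 1]
    rw [show II c (i + 1 + 1 * k') 1 1 = [c i] by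
      rw [II_succ, show i + 1 + 1 * k' = i + (k' + 1) by ring, hper]; rfl]
    exact List.perm_append_singleton _ _

theorem Opt.ham (h : Opt b r U k C x x' M y' y) {u e : V} {Q : List V} (hQ : Seg r u e Q)
    (hp : Q.Perm C) (hu : ¬ NN b x y u) (he : ¬ NN b x y e) : False := by
  obtain ⟨hux, huy⟩ := h.red hu
  obtain ⟨hex, hey⟩ := h.red he
  refine h.fin (D := []) (Q := ((x :: M) ++ [y]) ++ Q) (Or.inl rfl)
    ((((Seg.cons h.hx h.sM).snoc h.hy).app (h.ctx.rs _ _ huy) hQ).cyc hex) ?_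
  intro a
  have := hp.count_eq a
  simp only [List.count_append, List.count_cons, List.count_reverse, List.count_nil] at *
  omega

theorem bseg {c : ℕ → V} (hb : ∀ i, b (c i) (c (i + 1))) (i n j : ℕ) (hj : j = i + n) :
    Seg b (c i) (c j) (II c i (n + 1) 1) := by
  subst hj
  have := II_seg (R := b) c 1 n i (fun j => hb _)
  simpa using this

theorem per_mod {c : ℕ → V} (hper : ∀ i, c (i + k) = c i) (i t : ℕ) :
    c (i % k + t) = c (i + t) := by
  have key : ∀ q i, c (i + k * q) = c i := by
    intro q
    induction q with
    | zero => intro i; simp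
    | succ q ih => intro i; rw [Nat.mul_succ, ← Nat.add_assoc, hper, ih]
  conv_rhs => rw [← Nat.mod_add_div i k]
  rw [show i % k + k * (i / k) + t = (i % k + t) + k * (i / k) by ring, key]

theorem Opt.nonempty (h : Opt b r U k C x x' M y' y) : 0 < k := by
  rcases Nat.eq_zero_or_pos k with h0 | h0
  · exfalso
    have hk := h.len
    subst h0
    have : C = [] := by simpa using hk
    refine h.big (D := [x]) (Q := M ++ [y]) ((Seg.one x).cyc (h.ctx.br x)) (h.sM.snoc h.hy).pth ?_
      (by simp [this])
    intro a
    subst this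
    simp only [List.count_append, List.count_cons, List.count_reverse, List.count_nil] at *
    omega
  · exact h0

structure Par (b : V → V → Prop) (C : List V) (k : ℕ) (c : ℕ → V) : Prop where
  per : ∀ i, c (i + k) = c i
  hb : ∀ i, b (c i) (c (i + 1))
  eq : II c 0 k 1 = C
  pos : 0 < k

theorem Par.perm {c : ℕ → V} (p : Par b C k c) (i : ℕ) : (II c i k 1).Perm C := by
  rw [← p.eq]; exact II_rot c p.per i p.pos

theorem Opt.f1 (h : Opt b r U k C x x' M y' y) {c : ℕ → V} (p : Par b C k c) (i : ℕ)
    (hi : NN b x y (c i)) : ¬ NN b x y (c (i + 1)) := by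
  intro h2
  have h3 := p.perm (i + 1)
  have h4 := bseg p.hb (i + 1) (k - 1) (i + k) (by have := p.pos; omega)
  rw [Nat.sub_add_cancel p.pos, p.per] at h4
  exact h.F1 h4 h3 h2 hi

theorem Opt.f2 (h : Opt b r U k C x x' M y' y) {c : ℕ → V} (p : Par b C k c) (i : ℕ) (hk : 2 ≤ k)
    (hi : ¬ NN b x y (c (i + 1))) : r (c i) (c (i + 2)) := by
  have h3 := p.perm (i + 1)
  have h4 := bseg p.hb (i + 2) (k - 2) (i + k) (by omega)
  obtain ⟨k', rfl⟩ : ∃ k', k = k' + 2 := ⟨k - 2, by omega⟩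
  rw [p.per] at h4
  rw [II_succ] at h3
  exact h.ctx.rs _ _ (h.F2 h4 h3 hi)

theorem Opt.clp0 (h : Opt b r U k C x x' M y' y) {c : ℕ → V} (p : Par b C k c) {i j : ℕ}
    (hij : i < j) (hj : j < i + k) (hi : NN b x y (c i)) (hj2 : NN b x y (c j)) :
    r (c (i + 1)) (c (j + 1)) := by
  rcases h.ctx.tot (c (i + 1)) (c (j + 1)) with h1 | h1
  · exfalso
    have s1 := (bseg p.hb (i + 1) (j - i - 1) j (by omega)).rev h.ctx.bs
    have s2 := bseg p.hb (j + 1) (i + k - j - 1) (i + k) (by omega)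
    rw [p.per] at s2
    have h3 := p.perm (i + 1)
    rw [show k = (j - i - 1 + 1) + (i + k - j - 1 + 1) by omega, II_add,
      show i + 1 + 1 * (j - i - 1 + 1) = j + 1 by omega] at h3
    exact h.F1 (s1.app h1 s2) (((List.reverse_perm _).append_right _).trans h3) hj2 hi
  · exact h1

theorem Opt.clm0 (h : Opt b r U k C x x' M y' y) {c : ℕ → V} (p : Par b C k c) {i j : ℕ}
    (hij : i < j) (hj : j < i + k) (hi : NN b x y (c (i + 1))) (hj2 : NN b x y (c (j + 1))) :
    r (c i) (c j) := by
  rcases h.ctx.tot (c j) (c i) with h1 | h1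
  · exfalso
    have s1 := bseg p.hb (i + 1) (j - i - 1) j (by omega)
    have s2 := (bseg p.hb (j + 1) (i + k - j - 1) (i + k) (by omega)).rev h.ctx.bs
    rw [p.per] at s2
    have h3 := p.perm (i + 1)
    rw [show k = (j - i - 1 + 1) + (i + k - j - 1 + 1) by omega, II_add,
      show i + 1 + 1 * (j - i - 1 + 1) = j + 1 by omega] at h3
    exact h.F1 (s1.app h1 s2) (((List.reverse_perm _).append_left _).trans h3) hi hj2
  · exact h.ctx.rs _ _ h1

theorem Opt.clp (h : Opt b r U k C x x' M y' y) {c : ℕ → V} (p : Par b C k c) {i j : ℕ}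
    (hi : NN b x y (c i)) (hj : NN b x y (c j)) : r (c (i + 1)) (c (j + 1)) := by
  rw [← per_mod p.per i, ← per_mod p.per j]
  have e1 := per_mod p.per i 0
  have e2 := per_mod p.per j 0
  simp only [Nat.add_zero] at e1 e2
  rw [← e1] at hi
  rw [← e2] at hj
  have l1 := Nat.mod_lt i p.pos
  have l2 := Nat.mod_lt j p.pos
  rcases lt_trichotomy (i % k) (j % k) with h1 | h1 | h1
  · exact h.clp0 p h1 (by omega) hi hj
  · rw [h1]; exact h.ctx.rr _
  · exact h.ctx.rs _ _ (h.clp0 p h1 (by omega) hj hi)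

theorem Opt.clm (h : Opt b r U k C x x' M y' y) {c : ℕ → V} (p : Par b C k c) {i j : ℕ}
    (hi : NN b x y (c (i + 1))) (hj : NN b x y (c (j + 1))) : r (c i) (c j) := by
  have e1 := per_mod p.per i 0
  have e2 := per_mod p.per j 0
  simp only [Nat.add_zero] at e1 e2
  rw [← e1, ← e2]
  rw [← per_mod p.per i] at hi
  rw [← per_mod p.per j] at hj
  have l1 := Nat.mod_lt i p.pos
  have l2 := Nat.mod_lt j p.pos
  rcases lt_trichotomy (i % k) (j % k) with h1 | h1 | h1
  · exact h.clm0 p h1 (by omega) hi hj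
  · rw [h1]; exact h.ctx.rr _
  · exact h.ctx.rs _ _ (h.clm0 p h1 (by omega) hj hi)

def AA (b : V → V → Prop) (x y : V) (c : ℕ → V) (v : V) : Prop := ∃ i, NN b x y (c i) ∧ v = c (i + 1)
def BB (b : V → V → Prop) (x y : V) (c : ℕ → V) (v : V) : Prop := ∃ i, NN b x y (c (i + 1)) ∧ v = c i

/-- chains of steps of length 2 ending in `BB` close up to a red Hamiltonian path of the list -/
theorem Opt.join (h : Opt b r U k C x x' M y' y) {c : ℕ → V} (p : Par b C k c) {u z : V}
    {l : List V} (hl : Seg (TT r (AA b x y c) (BB b x y c)) u z l) (hz : BB b x y c z) :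
    ∃ l' e, Seg r u e l' ∧ l'.Perm l ∧ ¬ NN b x y e := by
  obtain ⟨l', e, h1, h2, h3⟩ := joinLem h.ctx.rs l.length (AA b x y c) (BB b x y c)
    (by rintro u v ⟨i, hi, rfl⟩ ⟨j, hj, rfl⟩; exact h.clp p hi hj)
    (by rintro u v ⟨i, hi, rfl⟩ ⟨j, hj, rfl⟩; exact h.clm p hi hj) l u z hl rfl hz
  refine ⟨l', e, h1, h2, ?_⟩
  rcases h3 with ⟨i, hi, rfl⟩ | ⟨i, hi, rfl⟩
  · exact h.f1 p i hi
  · intro h4; exact h.f1 p i h4 hi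

theorem Opt.step (h : Opt b r U k C x x' M y' y) {c : ℕ → V} (p : Par b C k c) (hk : 2 ≤ k)
    (i : ℕ) : TT r (AA b x y c) (BB b x y c) (c i) (c (i + 2)) := by
  by_cases h1 : NN b x y (c (i + 1))
  · exact Or.inr ⟨⟨i, h1, rfl⟩, ⟨i + 1, h1, rfl⟩⟩
  · exact Or.inl (h.f2 p i hk h1)

theorem seg2 {R : V → V → Prop} {c : ℕ → V} (i n j : ℕ) (hj : j = i + 2 * n)
    (hR : ∀ t, R (c (i + 2 * t)) (c (i + 2 * t + 2))) :
    Seg R (c i) (c j) (II c i (n + 1) 2) := by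
  subst hj
  exact II_seg (R := R) c 2 n i hR

/-- a red path from `c (i+1)` along step-2 chain with `n+1` vertices ending at `c j`,
either `i, j+1` are NN or there are no NN -/
theorem Opt.chain (h : Opt b r U k C x x' M y' y) {c : ℕ → V} (p : Par b C k c) (hk : 2 ≤ k)
    (i n : ℕ) (hN : NN b x y (c (i + 2 * n + 1)) ∨ ∀ t, ¬ NN b x y (c t)) :
    ∃ l' e, Seg r (c i) e l' ∧ l'.Perm (II c i (n + 1) 2) ∧ ¬ NN b x y e := by
  rcases hN with hN | hN
  · exact h.join p (seg2 i n _ rfl fun t => h.step p hk _) ⟨_, hN, rfl⟩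
  · exact ⟨_, _, seg2 i n _ rfl (fun t => h.f2 p _ hk (hN _)), List.Perm.refl _, hN _⟩

theorem Opt.k4 (h : Opt b r U k C x x' M y' y) {c : ℕ → V} (p : Par b C k c) : 4 ≤ k := by
  by_cases hk : 2 ≤ k
  · obtain ⟨i, hi⟩ : ∃ i, ¬ NN b x y (c (i + 1)) := by
      by_cases h1 : NN b x y (c 0)
      · exact ⟨0, h.f1 p 0 h1⟩
      · exact ⟨k - 1, by rw [Nat.sub_add_cancel p.pos, ← Nat.zero_add k, p.per]; exact h1⟩
    have h3 := p.perm (i + 1)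
    have h4 := bseg p.hb (i + 2) (k - 2) (i + k) (by omega)
    obtain ⟨k', rfl⟩ : ∃ k', k = k' + 2 := ⟨k - 2, by omega⟩
    rw [p.per] at h4
    rw [II_succ] at h3
    have := h.kge h4 h3 hi
    have := h.sM.fst.1
    omega
  · exfalso
    have hpos := p.pos
    have hk1 : k = 1 := by omega
    subst hk1
    have h3 := p.perm 0
    have h0 : ¬ NN b x y (c 0) := fun h0 => h.f1 p 0 h0 (by rw [p.per]; exact h0)
    exact h.ham (Seg.one (c 0)) h3 h0 h0

theorem Par.five {c : ℕ → V} (p : Par b C k c) (hk : 4 ≤ k) (i : ℕ) :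
    Five b C (c i) (c (i + 1)) (c (i + 2)) (c (i + 3)) (c (i + 4)) (II c (i + 4) (k - 3) 1) where
  e01 := p.hb _
  e12 := p.hb _
  e23 := p.hb _
  e34 := p.hb _
  sT := by
    have := bseg p.hb (i + 4) (k - 4) (i + k) (by omega)
    rw [p.per] at this
    rwa [show k - 3 = k - 4 + 1 by omega]
  perm := by
    have := p.perm (i + 1)
    rwa [show k = (k - 3) + 1 + 1 + 1 by omega, II_succ, II_succ, II_succ] at this

theorem II_odd {c : ℕ → V} (m : ℕ) (hper : ∀ i, c (i + (2 * m + 1)) = c i) (i : ℕ) :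
    (II c i (2 * m + 1) 2).Perm (II c i (2 * m + 1) 1) := by
  have h1 : II c i (2 * m + 1) 2 = II c i (m + 1) 2 ++ II c (i + 1) m 2 := by
    rw [show 2 * m + 1 = (m + 1) + m by ring, II_add,
      show i + 2 * (m + 1) = i + 1 + (2 * m + 1) by ring, II_per c _ hper]
  rw [h1, II_succ, II_succ]
  have := II_split c (i + 1) m
  refine List.Perm.cons _ ?_
  refine List.Perm.trans ?_ this.symm
  exact List.perm_append_comm

theorem Opt.odd (h : Opt b r U k C x x' M y' y) {c : ℕ → V} (p : Par b C k c) (hk : 4 ≤ k)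
    (m : ℕ) (hm : k = 2 * m + 1) : False := by
  obtain ⟨i, h0, hN⟩ : ∃ i, ¬ NN b x y (c i) ∧
      (NN b x y (c (i + 2 * (2 * m) + 1)) ∨ ∀ t, ¬ NN b x y (c t)) := by
    by_cases hz : ∃ z, NN b x y (c z)
    · obtain ⟨z, hz⟩ := hz
      refine ⟨z + 1, h.f1 p z hz, Or.inl ?_⟩
      rw [show z + 1 + 2 * (2 * m) + 1 = z + k + k by omega, p.per, p.per]
      exact hz
    · push Not at hz
      exact ⟨0, hz 0, Or.inr hz⟩
  obtain ⟨l, e, h1, h2, h3⟩ := h.chain p (by omega) i (2 * m) hN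
  have hper := p.per
  have := p.perm i
  subst hm
  exact h.ham h1 (h2.trans ((II_odd m hper i).trans this)) h0 h3

theorem II_two {c : ℕ → V} (m : ℕ) (hm : 0 < m) (hper : ∀ i, c (i + 2 * m) = c i) (i : ℕ) :
    (II c (i + 2) m 2).Perm (II c i m 2) := by
  obtain ⟨m, rfl⟩ : ∃ m', m = m' + 1 := ⟨m - 1, by omega⟩
  rw [II_add c (i + 2) m 1 2, II_succ c i m 2]
  rw [show II c (i + 2 + 2 * m) 1 2 = [c i] by
    rw [II_succ, show i + 2 + 2 * m = i + 2 * (m + 1) by ring, hper]; rfl]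
  exact List.perm_append_singleton _ _

theorem II_par {c : ℕ → V} (m : ℕ) (hm : 0 < m) (hper : ∀ i, c (i + 2 * m) = c i) (i t : ℕ) :
    (II c (i + 2 * t) m 2).Perm (II c i m 2) := by
  induction t with
  | zero => exact List.Perm.refl _
  | succ t ih => exact (II_two m hm hper _).trans ih

theorem II_par' {c : ℕ → V} (m : ℕ) (hm : 0 < m) (hper : ∀ i, c (i + 2 * m) = c i) (i j : ℕ)
    (hij : i % 2 = j % 2) : (II c i m 2).Perm (II c j m 2) := by
  rcases le_total i j with h | h
  · obtain ⟨t, ht⟩ : ∃ t, j = i + 2 * t := ⟨(j - i) / 2, by omega⟩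
    subst ht
    exact (II_par m hm hper i t).symm
  · obtain ⟨t, ht⟩ : ∃ t, i = j + 2 * t := ⟨(i - j) / 2, by omega⟩
    subst ht
    exact (II_par m hm hper j t)

theorem Par.pp {c : ℕ → V} {m : ℕ} (p : Par b C (2 * m) c) (hm : 0 < m) (i j : ℕ)
    (hij : i % 2 ≠ j % 2) : (II c i m 2 ++ II c j m 2).Perm C := by
  refine List.Perm.trans ?_ (p.perm i)
  refine List.Perm.trans ?_ (II_split c i m).symm
  exact (II_par' m hm p.per j (i + 1) (by omega)).append_left _

theorem Opt.even (h : Opt b r U k C x x' M y' y) {c : ℕ → V} (p : Par b C k c) (hk : 4 ≤ k)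
    (m : ℕ) (hm : k = 2 * m) : False := by
  subst hm
  have hm0 : 0 < m := by omega
  obtain ⟨m', hm'⟩ : ∃ m', m = m' + 1 := ⟨m - 1, by omega⟩
  have hper := p.per
  by_cases hop : ∃ z j, NN b x y (c z) ∧ NN b x y (c j) ∧ z % 2 ≠ j % 2
  · obtain ⟨z, j, hz, hj, hzj⟩ := hop
    have s1 := seg2 (z + 1) m' (z + 1 + 2 * m') rfl (fun t => h.step p (by omega) (z + 1 + 2 * t))
    have s2 := seg2 (j + 1) m' (j + 1 + 2 * m') rfl (fun t => h.step p (by omega) (j + 1 + 2 * t))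
    rw [← hm'] at s1 s2
    have B1 : BB b x y c (c (z + 1 + 2 * m')) := ⟨_, by
      rw [show z + 1 + 2 * m' + 1 = z + 2 * m by omega, hper]; exact hz, rfl⟩
    have B2 : BB b x y c (c (j + 1 + 2 * m')) := ⟨_, by
      rw [show j + 1 + 2 * m' + 1 = j + 2 * m by omega, hper]; exact hj, rfl⟩
    obtain ⟨l, e, k1, k2, k3⟩ := h.join p (s1.app (Or.inr ⟨B1, ⟨j, hj, rfl⟩⟩) s2) B2
    exact h.ham k1 (k2.trans (p.pp hm0 _ _ (by omega))) (h.f1 p _ hz) k3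
  · obtain ⟨z, hz, hz2, hpar⟩ : ∃ z, (NN b x y (c z) ∨ ∀ t, ¬ NN b x y (c t)) ∧
        ¬ NN b x y (c (z + 2)) ∧ ∀ j, z % 2 ≠ j % 2 → ¬ NN b x y (c j) := by
      by_cases hz : ∃ z, NN b x y (c z)
      · obtain ⟨z, hz⟩ := hz
        have hpar : ∀ j, z % 2 ≠ j % 2 → ¬ NN b x y (c j) := fun j h1 h2 => hop ⟨z, j, hz, h2, h1⟩
        by_cases h2 : NN b x y (c (z + 2))
        · exact ⟨z + 2, Or.inl h2, fun h4 => h.F5 (p.five hk z) hz h2 h4,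
            fun j hj => hpar j (by omega)⟩
        · exact ⟨z, Or.inl hz, h2, hpar⟩
      · push Not at hz
        exact ⟨0, Or.inr hz, hz _, fun j _ => hz j⟩
    obtain ⟨E, e, k1, k2, k3⟩ := h.chain p (by omega) (z + 1) m' (by
      rcases hz with hz | hz
      · left
        rw [show z + 1 + 2 * m' + 1 = z + 2 * m by omega, hper]; exact hz
      · exact Or.inr hz)
    rw [← hm'] at k2
    have s1 := (seg2 (R := r) (z + 4) m' (z + 2 + 2 * m) (by omega)
      (fun t => h.f2 p (z + 4 + 2 * t) (by omega) (hpar _ (by omega)))).rev h.ctx.rs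
    have s2 := (seg2 (R := r) (z + 2) m' (z + 2 * m) (by omega)
      (fun t => h.f2 p (z + 2 + 2 * t) (by omega) (hpar _ (by omega))))
    rw [← hm', hper] at s1 s2
    exact h.F6 (p.five hk z) (hpar _ (by omega)) hz2 (hpar _ (by omega)) k3 k1 s1 s2
      (((k2.append (List.reverse_perm _))).trans (p.pp hm0 _ _ (by omega)))
      (((k2.append_right _)).trans (p.pp hm0 _ _ (by omega)))

theorem Opt.false (h : Opt b r U k C x x' M y' y) : False := by
  obtain ⟨c, h1, h2, h3⟩ := cyc_fun h.cyc h.len h.nonempty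
  have p : Par b C k c := ⟨h1, h2, h3, h.nonempty⟩
  have hk := h.k4 p
  rcases Nat.even_or_odd' k with ⟨m, hm | hm⟩
  · exact h.even p hk m hm
  · exact h.odd p hk m hm


theorem Seg.unsnoc {R : V → V → Prop} {u v : V} {l : List V} (h : Seg R u v l) :
    (l = [u] ∧ u = v) ∨ ∃ w l', Seg R u w l' ∧ R w v ∧ l = l' ++ [v] := by
  induction h with
  | one u => exact Or.inl ⟨rfl, rfl⟩
  | @cons u w v l h1 h2 ih =>
    right
    rcases ih with ⟨rfl, rfl⟩ | ⟨w', l', h3, h4, rfl⟩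
    · exact ⟨u, [u], Seg.one u, h1, rfl⟩
    · exact ⟨w', u :: l', Seg.cons h1 h3, h4, rfl⟩

theorem Seg.uncons {R : V → V → Prop} {u v : V} {l : List V} (h : Seg R u v l) :
    ∃ t, l = u :: t ∧ Pth R t := by
  cases h with
  | one => exact ⟨[], rfl, Or.inl rfl⟩
  | cons h1 h2 => exact ⟨_, rfl, h2.pth⟩

theorem E1 {R S : V → V → Prop} (Rs : ∀ u v, R u v → R v u) (Ss : ∀ u v, S u v → S v u)
    (l : List V) (tot : ∀ u ∈ l, ∀ v ∈ l, R u v ∨ S u v) :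
    ∃ Q1 Q2, Pth R Q1 ∧ Pth S Q2 ∧ (Q1 ++ Q2).Perm l := by
  induction l with
  | nil => exact ⟨[], [], Or.inl rfl, Or.inl rfl, List.Perm.refl _⟩
  | cons v l ih =>
    obtain ⟨Q1, Q2, h1, h2, hp⟩ := ih fun u hu v hv => tot u (List.mem_cons_of_mem _ hu) v
      (List.mem_cons_of_mem _ hv)
    rcases h1 with rfl | ⟨b1, b2, h1⟩
    · exact ⟨[v], Q2, (Seg.one v).pth, h2, hp.cons _⟩
    rcases h2 with rfl | ⟨r1, r2, h2⟩
    · refine ⟨Q1, [v], h1.pth, (Seg.one v).pth, ?_⟩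
      rw [List.perm_iff_count]
      intro a; have := hp.count_eq a
      simp only [List.count_append, List.count_cons, List.count_reverse, List.count_nil] at *; omega
    obtain ⟨t1, e1, p1⟩ := h1.uncons
    obtain ⟨t2, e2, p2⟩ := h2.uncons
    have m1 : b1 ∈ v :: l := List.mem_cons_of_mem _ (hp.subset (by simp [e1]))
    have m2 : r1 ∈ v :: l := List.mem_cons_of_mem _ (hp.subset (by simp [e2]))
    have mv : v ∈ v :: l := by simp
    rcases tot v mv b1 m1 with c1 | c1
    · exact ⟨v :: Q1, Q2, (Seg.cons c1 h1).pth, h2.pth, hp.cons _⟩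
    rcases tot v mv r1 m2 with c2 | c2
    swap
    · refine ⟨Q1, v :: Q2, h1.pth, (Seg.cons c2 h2).pth, ?_⟩
      rw [List.perm_iff_count]
      intro a; have := hp.count_eq a
      simp only [List.count_append, List.count_cons, List.count_reverse, List.count_nil] at *; omega
    rcases tot b1 m1 r1 m2 with c3 | c3
    · refine ⟨v :: r1 :: Q1, t2, (Seg.cons c2 (Seg.cons (Rs _ _ c3) h1)).pth, p2, ?_⟩
      subst e2
      rw [List.perm_iff_count]
      intro a; have := hp.count_eq a
      simp only [List.count_append, List.count_cons, List.count_reverse, List.count_nil] at *; omega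
    · refine ⟨t1, v :: b1 :: Q2, p1, (Seg.cons c1 (Seg.cons c3 h2)).pth, ?_⟩
      subst e1
      rw [List.perm_iff_count]
      intro a; have := hp.count_eq a
      simp only [List.count_append, List.count_cons, List.count_reverse, List.count_nil] at *; omega

theorem exists_max (P : ℕ → Prop) (N n : ℕ) (hn : P n) (hN : ∀ m, P m → m ≤ N) :
    ∃ m, P m ∧ ∀ m', P m' → m' ≤ m := by
  classical
  exact ⟨Nat.findGreatest P N, Nat.findGreatest_spec (hN n hn) hn,
    fun m' hm' => Nat.le_findGreatest (hN m' hm') hm'⟩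

theorem E2 {R S : V → V → Prop} (Rs : ∀ u v, R u v → R v u) (Ss : ∀ u v, S u v → S v u)
    (l : List V) (tot : ∀ u ∈ l, ∀ v ∈ l, R u v ∨ S u v) :
    ∃ Q1 Q2, (Q1 ++ Q2).Perm l ∧ ((Q2 = [] ∧ Pth R Q1) ∨ ∃ b1 b2 r1 r2, Seg R b1 b2 Q1 ∧
      Seg S r1 r2 Q2 ∧ S b1 r1 ∧ S b1 r2 ∧ S b2 r1 ∧ S b2 r2) := by
  obtain ⟨Q1, Q2, h1, h2, hp⟩ := E1 Rs Ss l tot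
  obtain ⟨m, ⟨Q1, Q2, h1, h2, hp, hm⟩, hmax⟩ := exists_max
    (fun n => ∃ Q1 Q2, Pth R Q1 ∧ Pth S Q2 ∧ (Q1 ++ Q2).Perm l ∧ Q1.length = n) l.length _
    ⟨Q1, Q2, h1, h2, hp, rfl⟩ (by
      rintro m ⟨Q1, Q2, h1, h2, hp, rfl⟩
      have := hp.length_eq
      simp at this; omega)
  refine ⟨Q1, Q2, hp, ?_⟩
  rcases h2 with rfl | ⟨r1, r2, h2⟩
  · exact Or.inl ⟨rfl, h1⟩
  right
  rcases h1 with rfl | ⟨b1, b2, h1⟩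
  · exfalso
    obtain ⟨t, rfl, ht⟩ := h2.uncons
    have := hmax 1 ⟨[r1], t, (Seg.one _).pth, ht, hp, rfl⟩
    simp at hm; omega
  have key : ∀ b1 b2 r1 r2 Q1 Q2, Seg R b1 b2 Q1 → Seg S r1 r2 Q2 → (Q1 ++ Q2).Perm l →
      Q1.length = m → S b1 r1 := by
    intro b1 b2 r1 r2 Q1 Q2 h1 h2 hp hm
    obtain ⟨t1, e1, p1⟩ := h1.uncons
    obtain ⟨t2, e2, p2⟩ := h2.uncons
    rcases tot b1 (hp.subset (by simp [e1])) r1 (hp.subset (by simp [e2])) with c | c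
    · exfalso
      have := hmax (m + 1) ⟨r1 :: Q1, t2, (Seg.cons (Rs _ _ c) h1).pth, p2, by
        subst e2
        rw [List.perm_iff_count]
        intro a; have := hp.count_eq a
        simp only [List.count_append, List.count_cons, List.count_reverse, List.count_nil] at *
        omega, by simp [hm]⟩
      omega
    · exact c
  have q1 := (List.reverse_perm Q1)
  have q2 := (List.reverse_perm Q2)
  exact ⟨b1, b2, r1, r2, h1, h2, key _ _ _ _ _ _ h1 h2 hp hm,
    key _ _ _ _ _ _ h1 (h2.rev Ss) ((q2.append_left _).trans hp) hm,
    key _ _ _ _ _ _ (h1.rev Rs) h2 ((q1.append_right _).trans hp) (by simpa using hm),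
    key _ _ _ _ _ _ (h1.rev Rs) (h2.rev Ss) ((q1.append q2).trans hp) (by simpa using hm)⟩

theorem lehelCore (bs : ∀ u v, b u v → b v u) (rs : ∀ u v, r u v → r v u) (br : ∀ u, b u u)
    (rr : ∀ u, r u u) (tot : ∀ u v, b u v ∨ r u v)
    (hb : ∀ C P, Cyc b C → Pth r P → (∀ a, (C ++ P).count a = U a) → C.length ≤ k)
    (hr : ∀ C P, Cyc r C → Pth b P → (∀ a, (C ++ P).count a = U a) → C.length ≤ k)
    {P : List V} (hC : Cyc b C) (hP : Pth r P) (hc : ∀ a, (C ++ P).count a = U a)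
    (hk : C.length = k) : ∃ C P, Cyc b C ∧ Cyc r P ∧ ∀ a, (C ++ P).count a = U a := by
  by_contra hno
  have ctx : Ctx b r U k := ⟨bs, rs, br, rr, tot, hb, hr, fun C P h1 h2 h3 => hno ⟨C, P, h1, h2, h3⟩⟩
  rcases hP with rfl | ⟨x, y, hP⟩
  · exact hno ⟨C, [], hC, Or.inl rfl, hc⟩
  cases hP with
  | one => exact hno ⟨C, _, hC, (Seg.one x).cyc (rr x), hc⟩
  | @cons _ x' _ l h1 h2 =>
    rcases h2.unsnoc with ⟨rfl, rfl⟩ | ⟨y', M, h3, h4, rfl⟩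
    · exact hno ⟨C, _, hC, (Seg.cons h1 (Seg.one x')).cyc (rs _ _ h1), hc⟩
    · exact Opt.false (⟨ctx, hC, hk, h3, h1, h4, by
        intro a
        have := hc a
        simp only [List.count_append, List.count_cons, List.count_reverse, List.count_nil] at *
        omega⟩ : Opt b r U k C x x' M y' y)

theorem lehel (bs : ∀ u v, b u v → b v u) (rs : ∀ u v, r u v → r v u) (br : ∀ u, b u u)
    (rr : ∀ u, r u u) (tot : ∀ u v, b u v ∨ r u v) (l : List V) :
    ∃ C P, Cyc b C ∧ Cyc r P ∧ (C ++ P).Perm l := by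
  let PP : ℕ → Prop := fun n => ∃ C P, ((Cyc b C ∧ Pth r P) ∨ (Cyc r C ∧ Pth b P)) ∧
    (C ++ P).Perm l ∧ C.length = n
  have h0 : ∃ n, PP n := by
    obtain ⟨Q1, Q2, hp, ⟨rfl, h1⟩ | ⟨b1, b2, r1, r2, h1, h2, h3, h4, _, _⟩⟩ :=
      E2 bs rs l (fun u _ v _ => tot u v)
    · exact ⟨0, [], Q1, Or.inr ⟨Or.inl rfl, h1⟩, by simpa using hp, rfl⟩
    · obtain ⟨t, rfl, ht⟩ := h1.uncons
      refine ⟨_, b1 :: Q2, t, Or.inr ⟨(Seg.cons h3 h2).cyc (rs _ _ h4), ht⟩, ?_, rfl⟩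
      rw [List.perm_iff_count]
      intro a; have := hp.count_eq a
      simp only [List.count_append, List.count_cons, List.count_reverse, List.count_nil] at *
      omega
  obtain ⟨n, hn⟩ := h0
  obtain ⟨k, ⟨C, P, h1, hp, hk⟩, hmax⟩ := exists_max PP l.length n hn (by
    rintro m ⟨C, P, _, hp, rfl⟩
    have := hp.length_eq
    simp at this; omega)
  have hb : ∀ C P, Cyc b C → Pth r P → (∀ a, (C ++ P).count a = l.count a) → C.length ≤ k :=
    fun C P h1 h2 h3 => hmax _ ⟨C, P, Or.inl ⟨h1, h2⟩, List.perm_iff_count.2 h3, rfl⟩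
  have hr : ∀ C P, Cyc r C → Pth b P → (∀ a, (C ++ P).count a = l.count a) → C.length ≤ k :=
    fun C P h1 h2 h3 => hmax _ ⟨C, P, Or.inr ⟨h1, h2⟩, List.perm_iff_count.2 h3, rfl⟩
  rcases h1 with ⟨h1, h2⟩ | ⟨h1, h2⟩
  · obtain ⟨C, P, h3, h4, h5⟩ := lehelCore bs rs br rr tot hb hr h1 h2
      (fun a => hp.count_eq a) hk
    exact ⟨C, P, h3, h4, List.perm_iff_count.2 h5⟩
  · obtain ⟨C, P, h3, h4, h5⟩ := lehelCore rs bs rr br (fun u v => (tot u v).symm) hr hb h1 h2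
      (fun a => hp.count_eq a) hk
    exact ⟨P, C, h4, h3, (List.perm_append_comm).trans (List.perm_iff_count.2 h5)⟩


def Cov (R : V → V → Prop) : ℕ → List V → Prop
  | 0, X => X = []
  | p + 1, X => ∃ u v l X', Seg R u v l ∧ Cov R p X' ∧ (l ++ X').Perm X

theorem Cov.perm {R : V → V → Prop} {p : ℕ} {X Y : List V} (h : Cov R p X) (hp : X.Perm Y) :
    Cov R p Y := by
  cases p with
  | zero => 
    have h : X = [] := h
    subst h
    exact List.nil_perm.1 hp
  | succ p =>
    obtain ⟨u, v, l, X', h1, h2, h3⟩ := h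
    exact ⟨u, v, l, X', h1, h2, h3.trans hp⟩

theorem Cov.le {R : V → V → Prop} {p : ℕ} {X : List V} (h : Cov R p X) : p ≤ X.length := by
  induction p generalizing X with
  | zero => omega
  | succ p ih =>
    obtain ⟨u, v, l, X', h1, h2, h3⟩ := h
    have := ih h2
    have := h1.fst.1
    have := h3.length_eq
    simp at this
    omega

theorem Cov.single (R : V → V → Prop) (X : List V) : Cov R X.length X := by
  induction X with
  | nil => rfl
  | cons v X ih => exact ⟨v, v, [v], X, Seg.one v, ih, List.Perm.refl _⟩

theorem Cov.split {R : V → V → Prop} {p : ℕ} {X : List V} (h : Cov R p X) (hlt : p < X.length) :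
    Cov R (p + 1) X := by
  induction p generalizing X with
  | zero =>
    have h : X = [] := h
    subst h
    simp at hlt
  | succ p ih =>
    obtain ⟨u, v, l, X', h1, h2, h3⟩ := h
    cases h1 with
    | one =>
      have := h3.length_eq
      simp at this
      exact ⟨u, u, [u], X', Seg.one u, ih h2 (by omega), h3⟩
    | @cons _ w _ l h4 h5 =>
      exact ⟨u, u, [u], l ++ X', Seg.one u, ⟨w, v, l, X', h5, h2, List.Perm.refl _⟩, h3⟩

theorem Cov.up {R : V → V → Prop} {p q : ℕ} {X : List V} (h : Cov R p X) (hpq : p ≤ q)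
    (hq : q ≤ X.length) : Cov R q X := by
  induction q, hpq using Nat.le_induction with
  | base => exact h
  | succ q hpq ih => exact (ih (by omega)).split (by omega)

theorem Pth.cov {R : V → V → Prop} {p : ℕ} {X : List V} (h : Pth R X) (hp : 1 ≤ p)
    (hq : p ≤ X.length) : Cov R p X := by
  rcases h with rfl | ⟨u, v, h⟩
  · simp at hq; omega
  · exact Cov.up (p := 1) ⟨u, v, X, [], h, rfl, by simp⟩ hp hq

theorem Pth.appd {R : V → V → Prop} {l1 l2 : List V} (h : Pth R (l1 ++ l2)) :
    Pth R l1 ∧ Pth R l2 := by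
  induction l1 with
  | nil => exact ⟨Or.inl rfl, h⟩
  | cons a t ih =>
    rcases h with h | ⟨u, v, h⟩
    · simp at h
    rw [List.cons_append] at h
    generalize hm : t ++ l2 = m at h
    cases h with
    | one =>
      simp at hm
      obtain ⟨rfl, rfl⟩ := hm
      exact ⟨(Seg.one _).pth, Or.inl rfl⟩
    | @cons _ w _ _ h1 h2 =>
      subst hm
      obtain ⟨h3, h4⟩ := ih h2.pth
      refine ⟨?_, h4⟩
      rcases h3 with rfl | ⟨u', v', h3⟩
      · exact (Seg.one _).pth
      · obtain ⟨t', rfl, _⟩ := h3.uncons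
        rw [List.cons_append] at h2
        have : w = u' := by
          obtain ⟨t2, e2, _⟩ := h2.uncons
          injection e2 with e3 _
          exact e3.symm
        subst this
        exact (Seg.cons h1 h3).pth

theorem inter0 {R : V → V → Prop} (Rs : ∀ u v, R u v → R v u) (n : ℕ) (X Y : List V)
    (hXY : ∀ x ∈ X, ∀ y ∈ Y, R x y) (hX : Cov R (n + 1) X) (hY : Cov R (n + 1) Y) :
    ∃ u v L, Seg R u v L ∧ L.Perm (X ++ Y) ∧ u ∈ X ∧ v ∈ Y := by
  induction n generalizing X Y with
  | zero =>
    obtain ⟨u, v, l, X', h1, rfl, h3⟩ := hX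
    obtain ⟨u', v', l', Y', h1', rfl, h3'⟩ := hY
    rw [List.append_nil] at h3 h3'
    have a1 : u ∈ X := h3.subset (by obtain ⟨t, rfl, _⟩ := h1.uncons; simp)
    have a2 : v ∈ X := h3.subset (by
      have := (h1.rev Rs).uncons
      obtain ⟨t, e, _⟩ := this
      rw [← List.mem_reverse, e]; simp)
    have b1 : u' ∈ Y := h3'.subset (by obtain ⟨t, rfl, _⟩ := h1'.uncons; simp)
    have b2 : v' ∈ Y := h3'.subset (by
      have := (h1'.rev Rs).uncons
      obtain ⟨t, e, _⟩ := this
      rw [← List.mem_reverse, e]; simp)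
    exact ⟨u, v', l ++ l', h1.app (hXY _ a2 _ b1) h1', h3.append h3', a1, b2⟩
  | succ n ih =>
    obtain ⟨u, v, l, X', h1, h2, h3⟩ := hX
    obtain ⟨u', v', l', Y', h1', h2', h3'⟩ := hY
    have a1 : u ∈ X := h3.subset (by obtain ⟨t, rfl, _⟩ := h1.uncons; simp)
    have a2 : v ∈ X := h3.subset (by
      have := (h1.rev Rs).uncons
      obtain ⟨t, e, _⟩ := this
      rw [List.mem_append, ← List.mem_reverse, e]; simp)
    have b1 : u' ∈ Y := h3'.subset (by obtain ⟨t, rfl, _⟩ := h1'.uncons; simp)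
    have b2 : v' ∈ Y := h3'.subset (by
      have := (h1'.rev Rs).uncons
      obtain ⟨t, e, _⟩ := this
      rw [List.mem_append, ← List.mem_reverse, e]; simp)
    have sX : ∀ x ∈ X', x ∈ X := fun x hx => h3.subset (by simp [hx])
    have sY : ∀ x ∈ Y', x ∈ Y := fun x hx => h3'.subset (by simp [hx])
    obtain ⟨u2, v2, L, k1, k2, k3, k4⟩ := ih X' Y' (fun x hx y hy => hXY x (sX x hx) y (sY y hy))
      h2 h2'
    refine ⟨u, v2, (l ++ l') ++ L, (h1.app (hXY _ a2 _ b1) h1').app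
      (Rs _ _ (hXY _ (sX _ k3) _ b2)) k1, ?_, a1, sY _ k4⟩
    rw [List.perm_iff_count]
    intro a
    have := h3.count_eq a
    have := h3'.count_eq a
    have := k2.count_eq a
    simp only [List.count_append] at *
    omega

theorem inter {R : V → V → Prop} (Rs : ∀ u v, R u v → R v u) {n : ℕ} {X Y : List V}
    (hn : 1 ≤ n) (hXY : ∀ x ∈ X, ∀ y ∈ Y, R x y) (hX : Cov R n X) (hY : Cov R n Y) :
    ∃ L, Cyc R L ∧ L.Perm (X ++ Y) := by
  obtain ⟨n, rfl⟩ : ∃ m, n = m + 1 := ⟨n - 1, by omega⟩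
  obtain ⟨u, v, L, h1, h2, h3, h4⟩ := inter0 Rs n X Y hXY hX hY
  exact ⟨L, h1.cyc (Rs _ _ (hXY _ h3 _ h4)), h2⟩

theorem dich {R S : V → V → Prop} (Rs : ∀ u v, R u v → R v u) (Ss : ∀ u v, S u v → S v u)
    (X : List V) (tot : ∀ u ∈ X, ∀ v ∈ X, R u v ∨ S u v) (hX : X ≠ []) :
    ∃ p q, 1 ≤ p ∧ 1 ≤ q ∧ Cov R p X ∧ Cov S q X ∧ (p + q ≤ X.length ∨
      (p + q = X.length + 1 ∧ ∃ X', X'.Perm X ∧ (Cyc R X' ∨ Cyc S X'))) := by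
  have hpos : 0 < X.length := List.length_pos_iff.2 hX
  obtain ⟨Q1, Q2, hp, ⟨rfl, h1⟩ | ⟨b1, b2, r1, r2, h1, h2, h3, h4, h5, h6⟩⟩ := E2 Rs Ss X tot
  · rw [List.append_nil] at hp
    have hl := hp.length_eq
    have c1 : Cov R 1 X := (h1.cov le_rfl (by omega)).perm hp
    rcases h1 with rfl | ⟨u, v, h1⟩
    · simp at hl; omega
    have cycR : Cyc R Q1 → ∃ p q, 1 ≤ p ∧ 1 ≤ q ∧ Cov R p X ∧ Cov S q X ∧ (p + q ≤ X.length ∨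
      (p + q = X.length + 1 ∧ ∃ X', X'.Perm X ∧ (Cyc R X' ∨ Cyc S X'))) := fun h =>
      ⟨1, X.length, le_rfl, hpos, c1, Cov.single S X, Or.inr ⟨by omega, Q1, hp, Or.inl h⟩⟩
    have hm : ∀ a ∈ Q1, a ∈ X := fun a => (hp.subset ·)
    cases h1 with
    | one =>
      rcases tot u (hm _ (by simp)) u (hm _ (by simp)) with h | h
      · exact cycR ((Seg.one u).cyc h)
      · exact ⟨1, X.length, le_rfl, hpos, c1, Cov.single S X,
          Or.inr ⟨by omega, _, hp, Or.inr ((Seg.one u).cyc h)⟩⟩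
    | @cons _ w _ l h7 h8 =>
      rcases h8.unsnoc with ⟨rfl, rfl⟩ | ⟨y', M, h9, h10, rfl⟩
      · exact cycR ((Seg.cons h7 (Seg.one w)).cyc (Rs _ _ h7))
      · rcases tot v (hm _ (by simp)) u (hm _ (by simp)) with h | h
        · exact cycR ((Seg.cons h7 h8).cyc h)
        · have : Cov S (M.length + 1) X := by
            refine ⟨v, u, [v, u], M, Seg.cons h (Seg.one u), Cov.single S M, ?_⟩
            refine List.Perm.trans ?_ hp
            rw [List.perm_iff_count]
            intro a
            simp only [List.count_append, List.count_cons, List.count_reverse, List.count_nil] at *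
            omega
          simp at hl
          exact ⟨1, _, le_rfl, by omega, c1, this, Or.inl (by omega)⟩
  · have hl := hp.length_eq
    have c1 : Cov R (Q2.length + 1) X := ⟨b1, b2, Q1, Q2, h1, Cov.single R Q2, hp⟩
    rw [List.length_append] at hl
    cases h1 with
    | one =>
      have cy : Cyc S (b1 :: Q2) := (Seg.cons h3 h2).cyc (Ss _ _ h4)
      refine ⟨_, 1, by omega, le_rfl, c1, ⟨b1, r2, b1 :: Q2, [], Seg.cons h3 h2, rfl, by simpa using hp⟩,
        Or.inr ⟨by simp at hl; omega, _, hp, Or.inr cy⟩⟩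
    | @cons _ w _ l h7 h8 =>
      rcases h8.unsnoc with ⟨rfl, rfl⟩ | ⟨y', M, h9, h10, rfl⟩
      · refine ⟨_, 1, by omega, le_rfl, c1, ⟨b1, w, (b1 :: Q2) ++ [w], [],
          (Seg.cons h3 h2).snoc (Ss _ _ h6), rfl, ?_⟩, Or.inl (by simp at hl; omega)⟩
        refine List.Perm.trans ?_ hp
        rw [List.perm_iff_count]
        intro a
        simp only [List.count_append, List.count_cons, List.count_reverse, List.count_nil] at *
        omega
      · refine ⟨_, M.length + 1, by omega, by omega, c1, ⟨b1, b2, (b1 :: Q2) ++ [b2], M,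
          (Seg.cons h3 h2).snoc (Ss _ _ h6), Cov.single S M, ?_⟩, Or.inl (by simp at hl; omega)⟩
        refine List.Perm.trans ?_ hp
        rw [List.perm_iff_count]
        intro a
        simp only [List.count_append, List.count_cons, List.count_reverse, List.count_nil] at *
        omega

theorem K2 {R S : V → V → Prop} (Rs : ∀ u v, R u v → R v u) (Ss : ∀ u v, S u v → S v u)
    (A B C : List V) (tot : ∀ u ∈ A, ∀ v ∈ A, R u v ∨ S u v) (hAB : ∀ u ∈ A, ∀ v ∈ B, R u v)
    (hAC : ∀ u ∈ A, ∀ v ∈ C, S u v) {p q : ℕ} (hp : 1 ≤ p) (hq : 1 ≤ q) (hB : Cov R p B)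
    (hC : Cov S q C) (hpq : p + q ≤ A.length) :
    ∃ X Y, Cyc R X ∧ Cyc S Y ∧ (X ++ Y).Perm (A ++ B ++ C) := by
  have hBl := hB.le
  have hCl := hC.le
  suffices h : ∃ m n A1 A2, p ≤ m ∧ q ≤ n ∧ m ≤ B.length ∧ n ≤ C.length ∧ Cov R m A1 ∧ Cov S n A2 ∧
      (A1 ++ A2).Perm A by
    obtain ⟨m, n, A1, A2, h1, h2, h3, h4, h5, h6, h7⟩ := h
    obtain ⟨X, k1, k2⟩ := inter Rs (by omega) (fun x hx y hy => hAB x (h7.subset (by simp [hx])) y hy)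
      h5 (hB.up h1 h3)
    obtain ⟨Y, k3, k4⟩ := inter Ss (by omega) (fun x hx y hy => hAC x (h7.subset (by simp [hx])) y hy)
      h6 (hC.up h2 h4)
    refine ⟨X, Y, k1, k3, ?_⟩
    rw [List.perm_iff_count]
    intro a
    have := h7.count_eq a
    have := k2.count_eq a
    have := k4.count_eq a
    simp only [List.count_append] at *
    omega
  by_cases hc : A.length ≤ B.length + C.length
  · obtain ⟨s, hs1, hs2, hs3, hs4, hs5⟩ : ∃ s, s ≤ A.length ∧ p ≤ s ∧ s ≤ B.length ∧
        q ≤ A.length - s ∧ A.length - s ≤ C.length := by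
      refine ⟨max p (A.length - C.length), ?_, ?_, ?_, ?_, ?_⟩ <;> omega
    have l1 : (A.take s).length = s := by simp; omega
    have l2 : (A.drop s).length = A.length - s := by simp
    refine ⟨s, A.length - s, A.take s, A.drop s, hs2, hs4, hs3, hs5, ?_, ?_, by simp⟩
    · have := Cov.single R (A.take s); rwa [l1] at this
    · have := Cov.single S (A.drop s); rwa [l2] at this
  · obtain ⟨Q1, Q2, h1, h2, hP⟩ := E1 Rs Ss A tot
    have hl := hP.length_eq
    rw [List.length_append] at hl
    refine ⟨B.length, C.length, ?_⟩
    by_cases c1 : Q1.length < B.length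
    · refine ⟨Q1 ++ Q2.take (B.length - Q1.length), Q2.drop (B.length - Q1.length), hBl, hCl,
        le_rfl, le_rfl, ?_, ?_, ?_⟩
      · have := Cov.single R (Q1 ++ Q2.take (B.length - Q1.length))
        rwa [List.length_append, List.length_take, show Q1.length + min (B.length - Q1.length) Q2.length
          = B.length by omega] at this
      · have h3 : Pth S (Q2.drop (B.length - Q1.length)) := by
          rw [← List.take_append_drop (B.length - Q1.length) Q2] at h2
          exact h2.appd.2
        exact h3.cov (by omega) (by simp; omega)
      · simpa using hP
    by_cases c2 : Q2.length < C.length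
    · refine ⟨Q1.take (A.length - C.length), Q1.drop (A.length - C.length) ++ Q2, hBl, hCl,
        le_rfl, le_rfl, ?_, ?_, ?_⟩
      · have h3 : Pth R (Q1.take (A.length - C.length)) := by
          rw [← List.take_append_drop (A.length - C.length) Q1] at h1
          exact h1.appd.1
        exact h3.cov (by omega) (by simp; omega)
      · have := Cov.single S (Q1.drop (A.length - C.length) ++ Q2)
        rwa [List.length_append, List.length_drop, show Q1.length - (A.length - C.length) + Q2.length
          = C.length by omega] at this
      · rw [← List.append_assoc]; simpa using hP
    · exact ⟨Q1, Q2, hBl, hCl, le_rfl, le_rfl, h1.cov (by omega) (by omega),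
        h2.cov (by omega) (by omega), hP⟩

/-- the triangle case -/
theorem triangle {R : ℕ → V → V → Prop} (Rs : ∀ i u v, R i u v → R i v u) (i j k : ℕ)
    (hij : i ≠ j) (hik : i ≠ k) (hjk : j ≠ k) (A B C : List V) (hA : A ≠ []) (hB : B ≠ [])
    (hC : C ≠ []) (tA : ∀ u ∈ A, ∀ v ∈ A, R i u v ∨ R j u v)
    (tB : ∀ u ∈ B, ∀ v ∈ B, R i u v ∨ R k u v) (tC : ∀ u ∈ C, ∀ v ∈ C, R j u v ∨ R k u v)
    (hAB : ∀ u ∈ A, ∀ v ∈ B, R i u v) (hAC : ∀ u ∈ A, ∀ v ∈ C, R j u v)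
    (hBC : ∀ u ∈ B, ∀ v ∈ C, R k u v) :
    ∃ c d X Y, c ≠ d ∧ Cyc (R c) X ∧ Cyc (R d) Y ∧ (X ++ Y).Perm (A ++ B ++ C) := by
  obtain ⟨p1A, p2A, a1, a2, a3, a4, a5⟩ := dich (Rs i) (Rs j) A tA hA
  obtain ⟨p1B, p3B, b1, b2, b3, b4, b5⟩ := dich (Rs i) (Rs k) B tB hB
  obtain ⟨p2C, p3C, c1, c2, c3, c4, c5⟩ := dich (Rs j) (Rs k) C tC hC
  by_cases k1 : p1B + p2C ≤ A.length
  · obtain ⟨X, Y, h1, h2, h3⟩ := K2 (Rs i) (Rs j) A B C tA hAB hAC b1 c1 b3 c3 k1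
    exact ⟨i, j, X, Y, hij, h1, h2, h3⟩
  by_cases k2 : p1A + p3C ≤ B.length
  · obtain ⟨X, Y, h1, h2, h3⟩ := K2 (Rs i) (Rs k) B A C tB
      (fun u hu v hv => Rs _ _ _ (hAB v hv u hu)) hBC a1 c2 a3 c4 k2
    exact ⟨i, k, X, Y, hik, h1, h2, h3.trans (List.perm_append_comm.append_right _)⟩
  by_cases k3 : p2A + p3B ≤ C.length
  · obtain ⟨X, Y, h1, h2, h3⟩ := K2 (Rs j) (Rs k) C A B tC
      (fun u hu v hv => Rs _ _ _ (hAC v hv u hu)) (fun u hu v hv => Rs _ _ _ (hBC v hv u hu))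
      a2 b2 a4 b4 k3
    refine ⟨j, k, X, Y, hjk, h1, h2, h3.trans ?_⟩
    rw [List.append_assoc]
    exact List.perm_append_comm
  have hb := b4.le
  have hc := c4.le
  obtain ⟨L, l1, l2⟩ := inter (Rs k) (n := max p3B p3C) (by omega) hBC
    (b4.up (by omega) (by omega)) (c4.up (by omega) (by omega))
  rcases a5 with a5 | ⟨a5, X, a6, a7⟩
  · omega
  have hp : (X ++ L).Perm (A ++ B ++ C) := by
    rw [List.append_assoc]; exact a6.append l2
  rcases a7 with a7 | a7
  · exact ⟨i, k, X, L, hik, a7, l1, hp⟩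
  · exact ⟨j, k, X, L, hjk, a7, l1, hp⟩


end Lehel

open Lehel in
theorem lehel_walk {n : ℕ} {χ : Fin n → Fin n → ℕ} (hsymm : ∀ u v, χ u v = χ v u) {col : ℕ}
    {u v : Fin n} {l : List (Fin n)} (h : Seg (fun u v => u = v ∨ χ u v = col) u v l)
    (hn : l.Nodup) : ∃ p : (⊤ : SimpleGraph (Fin n)).Walk u v, p.support = l ∧
      ∀ x y : Fin n, s(x, y) ∈ p.edges → χ x y = col := by
  induction h with
  | one u => exact ⟨SimpleGraph.Walk.nil, by simp, by simp⟩
  | @cons u w v l h1 h2 ih =>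
    obtain ⟨p, hp, he⟩ := ih (List.nodup_cons.1 hn).2
    have hne : u ≠ w := by
      rintro rfl
      obtain ⟨t, rfl, _⟩ := h2.uncons
      simp at hn
    have hcol := h1.resolve_left hne
    refine ⟨SimpleGraph.Walk.cons (by simpa using hne) p, by simp [hp], ?_⟩
    intro x y hxy
    rw [SimpleGraph.Walk.edges_cons, List.mem_cons] at hxy
    rcases hxy with hxy | hxy
    · rw [Sym2.eq_iff] at hxy
      rcases hxy with ⟨rfl, rfl⟩ | ⟨rfl, rfl⟩
      · exact hcol
      · rw [hsymm]; exact hcol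
    · exact he x y hxy

open Lehel in
theorem lehel_mono {n : ℕ} {χ : Fin n → Fin n → ℕ} (hsymm : ∀ u v, χ u v = χ v u) {col : ℕ}
    {l : List (Fin n)} (h : Cyc (fun u v => u = v ∨ χ u v = col) l)
    (hn : l.Nodup) : IsMonoCycle χ col l.toFinset := by
  rcases h with rfl | ⟨u, v, h, hvu⟩
  · left; simp
  right
  cases h with
  | one => left; exact ⟨u, by simp⟩
  | @cons _ w _ l h1 h2 =>
    right
    have hnl := (List.nodup_cons.1 hn).2
    have hul := (List.nodup_cons.1 hn).1
    cases h2 with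
    | one =>
      left
      have hne : u ≠ v := by simpa using hul
      exact ⟨u, v, hne, by simp, h1.resolve_left hne⟩
    | @cons _ w' _ l h2 h3 =>
      right
      obtain ⟨p, hp, he⟩ := lehel_walk hsymm (Seg.cons h1 (Seg.cons h2 h3)) hn
      have hv : v ∈ w :: l := by
        obtain ⟨_, e⟩ := (Seg.cons (R := fun u v => u = v ∨ χ u v = col) h2 h3).lst
        rw [← e]; exact List.getElem_mem _
      have hne : v ≠ u := by rintro rfl; exact hul hv
      have hcol := hvu.resolve_left hne
      have hvl : v ∈ l := by
        obtain ⟨_, e⟩ := h3.lst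
        rw [← e]; exact List.getElem_mem _
      have hvw : v ≠ w := by
        rintro rfl
        exact (List.nodup_cons.1 hnl).1 hvl
      refine ⟨v, SimpleGraph.Walk.cons (by simpa using hne) p, ?_, ?_, ?_⟩
      · rw [SimpleGraph.Walk.cons_isCycle_iff]
        refine ⟨?_, ?_⟩
        · rw [SimpleGraph.Walk.isPath_def, hp]; exact hn
        · cases p with
          | nil => simp at hp
          | @cons _ z _ ha q =>
            rw [SimpleGraph.Walk.support_cons] at hp
            injection hp with _ hp
            have hz : z = w := by
              have := (SimpleGraph.Walk.cons_tail_support q).symm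
              rw [hp] at this
              injection this with e _
              exact e.symm
            subst hz
            rw [SimpleGraph.Walk.edges_cons, List.mem_cons]
            rintro (h | h)
            · rw [Sym2.eq_iff] at h
              rcases h with ⟨h, _⟩ | ⟨h, _⟩
              · exact hne h
              · exact hvw h
            · have := SimpleGraph.Walk.snd_mem_support_of_mem_edges q h
              rw [hp] at this
              exact hul this
      · rw [SimpleGraph.Walk.support_cons, hp]
        ext a
        simp only [List.mem_toFinset, List.mem_cons]
        simp only [List.mem_cons] at hv
        constructor
        · rintro (rfl | h)
          · exact Or.inr hv
          · exact h
        · intro h; exact Or.inr h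
      · intro x y hxy
        rw [SimpleGraph.Walk.edges_cons, List.mem_cons] at hxy
        rcases hxy with hxy | hxy
        · rw [Sym2.eq_iff] at hxy
          rcases hxy with ⟨rfl, rfl⟩ | ⟨rfl, rfl⟩
          · exact hcol
          · rw [hsymm]; exact hcol
        · exact he x y hxy

open Lehel in
theorem lehel_finish {n : ℕ} {χ : Fin n → Fin n → ℕ} (hsymm : ∀ u v, χ u v = χ v u) {c d : ℕ}
    (hcd : c ≠ d) {X Y l : List (Fin n)} (hX : Cyc (fun u v => u = v ∨ χ u v = c) X)
    (hY : Cyc (fun u v => u = v ∨ χ u v = d) Y) (hp : (X ++ Y).Perm l) (hl : l.Nodup)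
    (hm : ∀ v, v ∈ l) :
    ∃ (S₁ S₂ : Finset (Fin n)) (c₁ c₂ : ℕ), c₁ ≠ c₂ ∧
      IsMonoCycle χ c₁ S₁ ∧ IsMonoCycle χ c₂ S₂ ∧
      Disjoint S₁ S₂ ∧ S₁ ∪ S₂ = Finset.univ := by
  have hn : (X ++ Y).Nodup := hp.nodup_iff.2 hl
  rw [List.nodup_append'] at hn
  obtain ⟨h1, h2, h3⟩ := hn
  refine ⟨X.toFinset, Y.toFinset, c, d, hcd, lehel_mono hsymm hX h1, lehel_mono hsymm hY h2, ?_, ?_⟩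
  · rw [List.disjoint_toFinset_iff_disjoint]; exact h3
  · ext v
    have := hp.mem_iff.2 (hm v)
    simpa using this

open Lehel in
theorem lehel_seg_class {n : ℕ} {χ : Fin n → Fin n → ℕ} {c : ℕ} {d : Fin n → ℕ}
    (hd : ∀ u v, u ≠ v → χ u v ≠ c → χ u v = d u ∧ d v = d u) {u v : Fin n} {l : List (Fin n)}
    (h : Seg (fun u v => u = v ∨ χ u v ≠ c) u v l) :
    d v = d u ∧ Seg (fun x y => x = y ∨ χ x y = d u) u v l := by
  induction h with
  | one u => exact ⟨rfl, Seg.one u⟩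
  | @cons u w v l h1 h2 ih =>
    have key : d w = d u ∧ (u = w ∨ χ u w = d u) := by
      by_cases huw : u = w
      · exact ⟨by rw [huw], Or.inl huw⟩
      · have := hd u w huw (h1.resolve_left huw)
        exact ⟨this.2, Or.inr this.1⟩
    rw [key.1] at ih
    exact ⟨ih.1, Seg.cons key.2 ih.2⟩

/-- pairwise intersecting 2-sets form a star or a triangle -/
theorem lehel_star_or {ι : Type*} (T : ι → Finset ℕ) (h2 : ∀ v, (T v).card = 2)
    (hI : ∀ u v, ∃ c, c ∈ T u ∧ c ∈ T v) :
    (∃ c, ∀ v, c ∈ T v) ∨ ∃ i j k : ℕ, i ≠ j ∧ i ≠ k ∧ j ≠ k ∧ (∃ v, T v = {i, j}) ∧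
      (∃ v, T v = {i, k}) ∧ (∃ v, T v = {j, k}) ∧
      ∀ v, T v = {i, j} ∨ T v = {i, k} ∨ T v = {j, k} := by
  by_cases hs : ∃ c, ∀ v, c ∈ T v
  · exact Or.inl hs
  right
  push Not at hs
  obtain ⟨v0, _⟩ := hs 0
  obtain ⟨a, b, hab, e0⟩ := Finset.card_eq_two.1 (h2 v0)
  obtain ⟨v1, h1⟩ := hs a
  obtain ⟨v2, h3⟩ := hs b
  have mk : ∀ (S : Finset ℕ) (x y : ℕ), S.card = 2 → x ≠ y → x ∈ S → y ∈ S → S = {x, y} := by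
    intro S x y hS hxy hx hy
    symm
    apply Finset.eq_of_subset_of_card_le
    · intro z hz
      simp only [Finset.mem_insert, Finset.mem_singleton] at hz
      rcases hz with rfl | rfl <;> assumption
    · rw [hS, Finset.card_pair hxy]
  have hb1 : b ∈ T v1 := by
    obtain ⟨c, hc, hc'⟩ := hI v0 v1
    rw [e0] at hc
    simp only [Finset.mem_insert, Finset.mem_singleton] at hc
    rcases hc with rfl | rfl
    · exact absurd hc' h1
    · exact hc'
  have ha2 : a ∈ T v2 := by
    obtain ⟨c, hc, hc'⟩ := hI v0 v2
    rw [e0] at hc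
    simp only [Finset.mem_insert, Finset.mem_singleton] at hc
    rcases hc with rfl | rfl
    · exact hc'
    · exact absurd hc' h3
  obtain ⟨d, hd1, hd2⟩ := hI v1 v2
  have hda : a ≠ d := by rintro rfl; exact h1 hd1
  have hdb : b ≠ d := by rintro rfl; exact h3 hd2
  have e1 := mk _ b d (h2 v1) hdb hb1 hd1
  have e2 := mk _ a d (h2 v2) hda ha2 hd2
  refine ⟨b, a, d, hab.symm, hdb, hda, ⟨v0, by rw [e0, Finset.pair_comm]⟩, ⟨v1, e1⟩, ⟨v2, e2⟩, ?_⟩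
  intro v
  obtain ⟨x, hx, hx'⟩ := hI v v0
  obtain ⟨y, hy, hy'⟩ := hI v v1
  obtain ⟨z, hz, hz'⟩ := hI v v2
  rw [e0] at hx'
  rw [e1] at hy'
  rw [e2] at hz'
  simp only [Finset.mem_insert, Finset.mem_singleton] at hx' hy' hz'
  have m1 : b ∈ T v → a ∈ T v → T v = {b, a} := mk _ _ _ (h2 v) hab.symm
  have m2 : b ∈ T v → d ∈ T v → T v = {b, d} := mk _ _ _ (h2 v) hdb
  have m3 : a ∈ T v → d ∈ T v → T v = {a, d} := mk _ _ _ (h2 v) hda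
  rcases hx' with rfl | rfl <;> rcases hy' with rfl | rfl <;> rcases hz' with rfl | rfl <;> tauto

/-- The vertex set of any `2`-locally coloured complete graph may be partitioned into two
disjoint monochromatic cycles of different colours. -/
theorem two_local_colouring_two_cycles (n : ℕ) (χ : Fin n → Fin n → ℕ)
    (hsymm : ∀ u v, χ u v = χ v u)
    (hloc : ∀ v : Fin n, ((Finset.univ.erase v).image (χ v)).card ≤ 2) :
    ∃ (S₁ S₂ : Finset (Fin n)) (c₁ c₂ : ℕ), c₁ ≠ c₂ ∧
      IsMonoCycle χ c₁ S₁ ∧ IsMonoCycle χ c₂ S₂ ∧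
      Disjoint S₁ S₂ ∧ S₁ ∪ S₂ = Finset.univ := by
  have hT : ∀ v, ∃ T : Finset ℕ, (Finset.univ.erase v).image (χ v) ⊆ T ∧ T.card = 2 := fun v =>
    Infinite.exists_superset_card_eq _ 2 (hloc v)
  choose T hT1 hT2 using hT
  have hmem : ∀ u v, u ≠ v → χ u v ∈ T u := fun u v huv =>
    hT1 u (Finset.mem_image.2 ⟨v, by simp [huv.symm], rfl⟩)
  have hmem' : ∀ u v, u ≠ v → χ u v ∈ T v := fun u v huv => by
    rw [hsymm]; exact hmem v u huv.symm
  have hl : (Finset.univ : Finset (Fin n)).toList.Nodup := Finset.nodup_toList _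
  have hm : ∀ v : Fin n, v ∈ (Finset.univ : Finset (Fin n)).toList := by simp
  generalize (Finset.univ : Finset (Fin n)).toList = l at hl hm
  have Rs : ∀ (i : ℕ) (u v : Fin n), (u = v ∨ χ u v = i) → (v = u ∨ χ v u = i) := by
    intro i u v h
    rw [hsymm v u, eq_comm]; exact h
  rcases lehel_star_or T hT2 (by
    intro u v
    by_cases huv : u = v
    · subst huv
      have : (T u).Nonempty := by rw [← Finset.card_pos, hT2]; omega
      obtain ⟨c, hc⟩ := this
      exact ⟨c, hc, hc⟩
    · exact ⟨_, hmem u v huv, hmem' u v huv⟩) with ⟨c, hc⟩ | ⟨i, j, k, hij, hik, hjk, ⟨va, hva⟩,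
        ⟨vb, hvb⟩, ⟨vc, hvc⟩, hall⟩
  · have hd : ∀ v, ∃ d, d ≠ c ∧ ∀ e ∈ T v, e = c ∨ e = d := by
      intro v
      obtain ⟨a, b, hab, e⟩ := Finset.card_eq_two.1 (hT2 v)
      have := hc v
      rw [e] at this ⊢
      simp only [Finset.mem_insert, Finset.mem_singleton] at this ⊢
      rcases this with rfl | rfl
      · exact ⟨b, hab.symm, fun e he => he⟩
      · exact ⟨a, hab, fun e he => he.symm⟩
    choose d hd1 hd2 using hd
    obtain ⟨C, P, h1, h2, h3⟩ := Lehel.lehel (b := fun u v => u = v ∨ χ u v = c)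
      (r := fun u v => u = v ∨ χ u v ≠ c) (Rs c)
      (by intro u v h; rw [hsymm v u, eq_comm]; exact h) (fun u => Or.inl rfl)
      (fun u => Or.inl rfl) (by intro u v; tauto) l
    rcases h2 with rfl | ⟨u, v, h2, h4⟩
    · exact lehel_finish hsymm (d := c + 1) (by omega) h1 (Or.inl rfl) h3 hl hm
    · have hcl : ∀ u v, u ≠ v → χ u v ≠ c → χ u v = d u ∧ d v = d u := by
        intro u v huv hne
        have e1 := (hd2 u _ (hmem u v huv)).resolve_left hne
        have e2 := (hd2 v _ (hmem' u v huv)).resolve_left hne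
        exact ⟨e1, by rw [← e2, e1]⟩
      obtain ⟨h5, h6⟩ := lehel_seg_class hcl h2
      refine lehel_finish hsymm (hd1 u).symm h1 (h6.cyc ?_) h3 hl hm
      by_cases hvu : v = u
      · exact Or.inl hvu
      · right
        rw [(hcl v u hvu (h4.resolve_left hvu)).1, h5]
  · let A := l.filter (fun v => T v = {i, j})
    let L := l.filter (fun v => !decide (T v = {i, j}))
    let B := L.filter (fun v => T v = {i, k})
    let C := L.filter (fun v => !decide (T v = {i, k}))
    have n1 : ({i, k} : Finset ℕ) ≠ {i, j} := by
      intro h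
      have : k ∈ ({i, j} : Finset ℕ) := by rw [← h]; simp
      simp only [Finset.mem_insert, Finset.mem_singleton] at this; omega
    have n2 : ({j, k} : Finset ℕ) ≠ {i, j} := by
      intro h
      have : k ∈ ({i, j} : Finset ℕ) := by rw [← h]; simp
      simp only [Finset.mem_insert, Finset.mem_singleton] at this; omega
    have n3 : ({j, k} : Finset ℕ) ≠ {i, k} := by
      intro h
      have : j ∈ ({i, k} : Finset ℕ) := by rw [← h]; simp
      simp only [Finset.mem_insert, Finset.mem_singleton] at this; omega
    have mA : ∀ v, v ∈ A ↔ T v = {i, j} := by intro v; simp [A, hm]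
    have mB : ∀ v, v ∈ B ↔ T v = {i, k} := by
      intro v
      simp only [B, L, List.mem_filter, hm, decide_eq_true_eq, Bool.not_eq_true',
        decide_eq_false_iff_not, true_and]
      constructor
      · exact fun h => h.2
      · intro h; exact ⟨by rw [h]; exact n1, h⟩
    have mC : ∀ v, v ∈ C ↔ T v = {j, k} := by
      intro v
      simp only [C, L, List.mem_filter, hm, decide_eq_true_eq, Bool.not_eq_true',
        decide_eq_false_iff_not, true_and]
      constructor
      · intro h; have := hall v; tauto
      · intro h; rw [h]; exact ⟨n2, n3⟩
    have hp : (A ++ B ++ C).Perm l := by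
      rw [List.append_assoc]
      refine List.Perm.trans ?_ (List.filter_append_perm (fun v => decide (T v = {i, j})) l)
      exact List.Perm.append_left _ (List.filter_append_perm (fun v => decide (T v = {i, k})) L)
    have tot : ∀ (p q : ℕ) (u v : Fin n), T u = {p, q} →
        (u = v ∨ χ u v = p) ∨ (u = v ∨ χ u v = q) := by
      intro p q u v hu
      by_cases huv : u = v
      · exact Or.inl (Or.inl huv)
      · have := hmem u v huv
        rw [hu] at this
        simp only [Finset.mem_insert, Finset.mem_singleton] at this
        tauto
    obtain ⟨c, d, X, Y, hcd, h1, h2, h3⟩ := Lehel.triangle (R := fun i u v => u = v ∨ χ u v = i) Rs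
      i j k hij hik hjk A B C (List.ne_nil_of_mem ((mA va).2 hva)) (List.ne_nil_of_mem ((mB vb).2 hvb))
      (List.ne_nil_of_mem ((mC vc).2 hvc)) (fun u hu v _ => tot _ _ _ _ ((mA u).1 hu))
      (fun u hu v _ => tot _ _ _ _ ((mB u).1 hu)) (fun u hu v _ => tot _ _ _ _ ((mC u).1 hu))
      (by
        intro u hu v hv
        rw [mA] at hu
        rw [mB] at hv
        by_cases huv : u = v
        · exact Or.inl huv
        have e1 := hmem u v huv
        have e2 := hmem' u v huv
        rw [hu] at e1
        rw [hv] at e2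
        simp only [Finset.mem_insert, Finset.mem_singleton] at e1 e2
        right; omega)
      (by
        intro u hu v hv
        rw [mA] at hu
        rw [mC] at hv
        by_cases huv : u = v
        · exact Or.inl huv
        have e1 := hmem u v huv
        have e2 := hmem' u v huv
        rw [hu] at e1
        rw [hv] at e2
        simp only [Finset.mem_insert, Finset.mem_singleton] at e1 e2
        right; omega)
      (by
        intro u hu v hv
        rw [mB] at hu
        rw [mC] at hv
        by_cases huv : u = v
        · exact Or.inl huv
        have e1 := hmem u v huv
        have e2 := hmem' u v huv
        rw [hu] at e1
        rw [hv] at e2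
        simp only [Finset.mem_insert, Finset.mem_singleton] at e1 e2
        right; omega)
    exact lehel_finish hsymm hcd h1 h2 (h3.trans hp) hl hm
end

section
/- For every r ≥ 1, every ℓ ≥ 3 and every n ≥ 2ℓr, every r-local edge colouring of the complete graph K_n contains a monochromatic cycle of length at least ℓ. In particular, any r-locally coloured complete graph on t vertices contains a monochromatic cycle of length at least t/(2r). -/
lemma lmc_cycle {V : Type*} [Fintype V] [DecidableEq V] [Nonempty V] (H : SimpleGraph V)
    [DecidableRel H.Adj] (k : ℕ) (hk : 2 ≤ k) (hne : ∃ a b, H.Adj a b)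
    (hd : ∀ v w, H.Adj v w → k ≤ (Finset.univ.filter (H.Adj v)).card) :
    ∃ (v : V) (p : H.Walk v v), p.IsCycle ∧ k + 1 ≤ p.length := by
  obtain ⟨u, v, p, hp, hmax⟩ := SimpleGraph.Walk.exists_isPath_forall_isPath_length_le_length H
  have hnbr : ∀ w, H.Adj u w → w ∈ p.support := by
    intro w hw
    by_contra hns
    have := hmax _ _ (SimpleGraph.Walk.cons hw.symm p) (hp.cons hns)
    simp at this
  have hu : ∃ w, H.Adj u w := by
    obtain ⟨a, b, hab⟩ := hne
    have h1 := hmax _ _ hab.toWalk hab.isPath_toWalk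
    cases p with
    | nil => simp at h1
    | cons h q => exact ⟨_, h⟩
  obtain ⟨w, hw⟩ := hu
  have hcard := hd u w hw
  let I := (Finset.range (p.length + 1)).filter (fun i => H.Adj u (p.getVert i))
  have hsub : Finset.univ.filter (H.Adj u) ⊆ I.image p.getVert := by
    intro x hx
    have hx' : H.Adj u x := by simpa using hx
    obtain ⟨i, hi, hle⟩ := SimpleGraph.Walk.mem_support_iff_exists_getVert.1 (hnbr x hx')
    refine Finset.mem_image.2 ⟨i, ?_, hi⟩
    simp only [I, Finset.mem_filter, Finset.mem_range]
    exact ⟨by omega, by rw [hi]; exact hx'⟩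
  have hI : k ≤ I.card := hcard.trans ((Finset.card_le_card hsub).trans Finset.card_image_le)
  have hIne : I.Nonempty := Finset.card_pos.1 (by omega)
  let j := I.max' hIne
  have hj : j ∈ I := I.max'_mem hIne
  have hIs : I ⊆ Finset.Icc 1 j := by
    intro i hi
    refine Finset.mem_Icc.2 ⟨?_, I.le_max' i hi⟩
    rcases Nat.eq_zero_or_pos i with h0 | h0
    · subst h0
      simp [I] at hi
    · exact h0
  have hkj : k ≤ j := by
    have := Finset.card_le_card hIs
    simp at this
    omega
  simp only [I, Finset.mem_filter, Finset.mem_range] at hj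
  have hlen : (p.take j).length = j := by
    simp only [SimpleGraph.Walk.take_length]
    omega
  refine ⟨_, SimpleGraph.Walk.cons hj.2.symm (p.take j), ?_, ?_⟩
  · rw [SimpleGraph.Walk.cons_isCycle_iff]
    refine ⟨hp.take j, fun hmem => ?_⟩
    rw [Sym2.eq_swap] at hmem
    have := (hp.take j).length_eq_one_of_mem_edges hmem
    omega
  · rw [SimpleGraph.Walk.length_cons, hlen]
    omega

lemma lmc_core {V : Type*} [DecidableEq V] (R : V → V → Prop) [DecidableRel R]
    (hs : ∀ a b, R a b → R b a) (hirr : ∀ a, ¬ R a a) (k : ℕ) (S : Finset V)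
    (h : 2 * S.card * k < ∑ v ∈ S, (S.filter (R v)).card) :
    ∃ T : Finset V, T.Nonempty ∧ ∀ v ∈ T, k + 1 ≤ (T.filter (R v)).card := by
  induction S using Finset.strongInduction with
  | H S ih =>
  by_cases hall : ∀ v ∈ S, k + 1 ≤ (S.filter (R v)).card
  · refine ⟨S, ?_, hall⟩
    by_contra hS
    rw [Finset.not_nonempty_iff_eq_empty] at hS
    subst hS
    simp at h
  · push Not at hall
    obtain ⟨v, hv, hvk⟩ := hall
    refine ih (S.erase v) (Finset.erase_ssubset hv) ?_
    have h1 : ∀ w ∈ S.erase v, (S.filter (R w)).card =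
        ((S.erase v).filter (R w)).card + if R v w then 1 else 0 := by
      intro w hw
      rw [Finset.filter_erase]
      split_ifs with hr
      · rw [Finset.card_erase_add_one]
        simp [hv, hs _ _ hr]
      · rw [Finset.erase_eq_of_notMem]
        · rfl
        · simp only [Finset.mem_filter, not_and]
          exact fun _ h' => hr (hs _ _ h')
    have h2 : ∑ w ∈ S.erase v, (if R v w then 1 else 0) = (S.filter (R v)).card := by
      rw [← Finset.card_filter, Finset.filter_erase, Finset.erase_eq_of_notMem]
      simp [hirr]
    rw [← Finset.add_sum_erase _ _ hv, Finset.sum_congr rfl h1, Finset.sum_add_distrib, h2] at h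
    have hc := Finset.card_erase_add_one hv
    rw [← hc] at h
    have : 2 * ((S.erase v).card + 1) * k = 2 * (S.erase v).card * k + 2 * k := by ring
    omega

lemma lmc_main (r k n : ℕ) (hr : 1 ≤ r) (hk : 2 ≤ k) (hn : 2 * k * r + 1 ≤ n)
    (χ : Fin n → Fin n → ℕ) (hsymm : ∀ u v, χ u v = χ v u)
    (hloc : ∀ v : Fin n, ((Finset.univ.erase v).image (χ v)).card ≤ r) :
    ∃ (col : ℕ) (v : Fin n) (p : (⊤ : SimpleGraph (Fin n)).Walk v v),
      p.IsCycle ∧ k + 1 ≤ p.length ∧ ∀ x y : Fin n, s(x, y) ∈ p.edges → χ x y = col := by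
  obtain ⟨k, rfl⟩ : ∃ m, k = m + 1 := ⟨k - 1, by omega⟩
  let R : ℕ → Fin n → Fin n → Prop := fun c a b => a ≠ b ∧ χ a b = c
  let C : Fin n → Finset ℕ := fun v => (Finset.univ.erase v).image (χ v)
  let A : Finset ℕ := Finset.univ.biUnion C
  let S : ℕ → Finset (Fin n) := fun c => Finset.univ.filter (fun v => c ∈ C v)
  have key : ∃ c, 2 * (S c).card * k < ∑ v ∈ S c, ((S c).filter (R c v)).card := by
    by_contra hcon
    push Not at hcon
    have hdeg : ∀ c, ∀ v ∈ S c, ((S c).filter (R c v)).card =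
        ((Finset.univ.erase v).filter (fun w => χ v w = c)).card := by
      intro c v hv
      congr 1
      ext w
      simp only [S, C, R, Finset.mem_filter, Finset.mem_univ, true_and, Finset.mem_erase,
        Finset.mem_image, and_true]
      constructor
      · rintro ⟨-, h1, h2⟩
        exact ⟨h1.symm, h2⟩
      · rintro ⟨h1, h2⟩
        exact ⟨⟨v, h1.symm, by rw [hsymm, h2]⟩, h1.symm, h2⟩
    have hsum : ∑ c ∈ A, ∑ v ∈ S c, ((S c).filter (R c v)).card = n * (n - 1) := by
      have : ∀ c ∈ A, ∑ v ∈ S c, ((S c).filter (R c v)).card =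
          ∑ v ∈ S c, ((Finset.univ.erase v).filter (fun w => χ v w = c)).card :=
        fun c _ => Finset.sum_congr rfl (hdeg c)
      rw [Finset.sum_congr rfl this]
      rw [Finset.sum_comm' (t' := Finset.univ) (s' := C)]
      · have : ∀ v ∈ (Finset.univ : Finset (Fin n)),
            ∑ c ∈ C v, ((Finset.univ.erase v).filter (fun w => χ v w = c)).card = n - 1 := by
          intro v _
          rw [← Finset.card_eq_sum_card_image]
          simp
        rw [Finset.sum_congr rfl this]
        simp
      · intro c v
        simp only [A, S, Finset.mem_biUnion, Finset.mem_filter, Finset.mem_univ, true_and, and_true]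
        exact ⟨fun h => h.2, fun h => ⟨⟨v, h⟩, h⟩⟩
    have hcardS : ∑ c ∈ A, (S c).card ≤ n * r := by
      have : ∑ c ∈ A, (S c).card = ∑ v : Fin n, (C v).card := by
        simp only [Finset.card_eq_sum_ones]
        rw [Finset.sum_comm' (t' := Finset.univ) (s' := C)]
        intro c v
        simp only [A, S, Finset.mem_biUnion, Finset.mem_filter, Finset.mem_univ, true_and, and_true]
        exact ⟨fun h => h.2, fun h => ⟨⟨v, h⟩, h⟩⟩
      rw [this]
      calc _ ≤ ∑ v : Fin n, r := Finset.sum_le_sum (fun v _ => hloc v)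
        _ = n * r := by simp
    have hle : n * (n - 1) ≤ 2 * k * (n * r) := by
      rw [← hsum]
      calc _ ≤ ∑ c ∈ A, 2 * (S c).card * k := Finset.sum_le_sum (fun c _ => hcon c)
        _ = 2 * k * ∑ c ∈ A, (S c).card := by
          rw [Finset.mul_sum]
          exact Finset.sum_congr rfl (fun c _ => by ring)
        _ ≤ _ := Nat.mul_le_mul_left _ hcardS
    have hn0 : 0 < n := by omega
    have h3 : n - 1 ≤ 2 * k * r := by
      apply Nat.le_of_mul_le_mul_left _ hn0
      calc _ ≤ _ := hle
        _ = _ := by ring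
    have h4 : 2 * (k + 1) * r = 2 * k * r + 2 * r := by ring
    omega
  obtain ⟨c, hc⟩ := key
  obtain ⟨T, ⟨t, ht⟩, hT⟩ := lmc_core (R c) (fun a b h => ⟨h.1.symm, by rw [hsymm]; exact h.2⟩)
    (fun a h => h.1 rfl) k (S c) hc
  let H : SimpleGraph (Fin n) :=
    { Adj := fun a b => R c a b ∧ a ∈ T ∧ b ∈ T
      symm := ⟨fun a b h => ⟨⟨h.1.1.symm, by rw [hsymm]; exact h.1.2⟩, h.2.2, h.2.1⟩⟩
      loopless := ⟨fun a h => h.1.1 rfl⟩ }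
  have : DecidableRel H.Adj := fun a b => inferInstanceAs (Decidable (R c a b ∧ a ∈ T ∧ b ∈ T))
  have : Nonempty (Fin n) := ⟨t⟩
  have hN : ∀ v ∈ T, k + 1 ≤ (Finset.univ.filter (H.Adj v)).card := by
    intro v hv
    refine (hT v hv).trans (Finset.card_le_card ?_)
    intro w hw
    rw [Finset.mem_filter] at hw
    exact Finset.mem_filter.2 ⟨Finset.mem_univ _, hw.2, hv, hw.1⟩
  obtain ⟨v, p, hp, hlen⟩ := lmc_cycle H (k + 1) hk (by
      have := hN t ht
      obtain ⟨w, hw⟩ := Finset.card_pos.1 (show 0 < (Finset.univ.filter (H.Adj t)).card by omega)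
      exact ⟨t, w, (Finset.mem_filter.1 hw).2⟩) (fun v w h => hN v h.2.1)
  refine ⟨c, v, p.mapLe le_top, (SimpleGraph.Walk.isCycle_mapLe le_top).2 hp, ?_, ?_⟩
  · rw [SimpleGraph.Walk.length_mapLe]
    exact hlen
  · intro x y hxy
    rw [SimpleGraph.Walk.edges_mapLe_eq_edges] at hxy
    exact (p.adj_of_mem_edges hxy).1.2

/-- For every `r ≥ 1`, `ℓ ≥ 3` and `n ≥ 2ℓr`, every `r`-local colouring of `K_n` contains
a monochromatic cycle of length at least `ℓ`; in particular, every `r`-locally coloured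
complete graph on `t` vertices contains a monochromatic cycle on at least `t/(2r)`
vertices. -/
theorem local_long_mono_cycle :
    (∀ (r ℓ n : ℕ), 1 ≤ r → 3 ≤ ℓ → 2 * ℓ * r ≤ n →
      ∀ χ : Fin n → Fin n → ℕ, (∀ u v, χ u v = χ v u) →
        (∀ v : Fin n, ((Finset.univ.erase v).image (χ v)).card ≤ r) →
        ∃ (col : ℕ) (v : Fin n) (p : (⊤ : SimpleGraph (Fin n)).Walk v v),
          p.IsCycle ∧ ℓ ≤ p.length ∧ ∀ x y : Fin n, s(x, y) ∈ p.edges → χ x y = col) ∧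
    (∀ (r t : ℕ), 1 ≤ r →
      ∀ χ : Fin t → Fin t → ℕ, (∀ u v, χ u v = χ v u) →
        (∀ v : Fin t, ((Finset.univ.erase v).image (χ v)).card ≤ r) →
        ∃ (col : ℕ) (S : Finset (Fin t)),
          IsMonoCycle χ col S ∧ (t : ℝ) / (2 * (r : ℝ)) ≤ (S.card : ℝ)) := by
  constructor
  · intro r ℓ n hr hl hn χ hs hloc
    obtain ⟨k, rfl⟩ : ∃ m, ℓ = m + 1 := ⟨ℓ - 1, by omega⟩
    have h4 : 2 * (k + 1) * r = 2 * k * r + 2 * r := by ring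
    exact lmc_main r k n hr (by omega) (by omega) χ hs hloc
  · intro r t hr χ hs hloc
    have hr0 : (0 : ℝ) < 2 * (r : ℝ) := by
      have : (1 : ℝ) ≤ r := by exact_mod_cast hr
      linarith
    have fin : ∀ m : ℕ, t ≤ m * (2 * r) → (t : ℝ) / (2 * (r : ℝ)) ≤ (m : ℝ) := by
      intro m hm
      rw [div_le_iff₀ hr0]
      exact_mod_cast hm
    rcases Nat.eq_zero_or_pos t with h0 | h0
    · exact ⟨0, ∅, Or.inl rfl, fin _ (by simp [h0])⟩
    -- k = ⌊(t-1)/(2r)⌋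
    let k := (t - 1) / (2 * r)
    have hk1 : k * (2 * r) ≤ t - 1 := Nat.div_mul_le_self _ _
    have hk2 : t - 1 < (k + 1) * (2 * r) := by
      have := Nat.lt_div_mul_add (a := t - 1) (b := 2 * r) (by omega)
      rw [add_mul, one_mul]
      exact this
    rcases Nat.lt_or_ge k 2 with hk | hk
    · rcases Nat.eq_zero_or_pos k with hk0 | hk0
      · refine ⟨0, {⟨0, h0⟩}, Or.inr (Or.inl ⟨_, rfl⟩), fin _ ?_⟩
        rw [hk0] at hk2
        simp only [Finset.card_singleton]
        omega
      · have hk1' : k = 1 := by omega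
        rw [hk1'] at hk1 hk2
        have hvw : (⟨0, h0⟩ : Fin t) ≠ ⟨1, by omega⟩ := by simp
        refine ⟨_, {⟨0, h0⟩, ⟨1, by omega⟩}, Or.inr (Or.inr (Or.inl ⟨_, _, hvw, rfl, rfl⟩)), fin _ ?_⟩
        rw [Finset.card_pair hvw]
        omega
    · have h5 : k * (2 * r) = 2 * k * r := by ring
      obtain ⟨c, v, p, hp, hlen, hcol⟩ := lmc_main r k t hr hk (by omega) χ hs hloc
      refine ⟨c, p.support.toFinset, Or.inr (Or.inr (Or.inr ⟨v, p, hp, rfl, hcol⟩)), fin _ ?_⟩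
      have hcard : p.length ≤ p.support.toFinset.card := by
        have h6 : p.support.tail.toFinset ⊆ p.support.toFinset := by
          intro x hx
          rw [List.mem_toFinset] at hx ⊢
          exact List.mem_of_mem_tail hx
        have h7 := Finset.card_le_card h6
        rw [List.toFinset_card_of_nodup hp.support_nodup] at h7
        simpa using h7
      have h8 : (k + 1) * (2 * r) ≤ p.support.toFinset.card * (2 * r) :=
        Nat.mul_le_mul_right _ (hlen.trans hcard)
      omega
end
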